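/- arXiv:0902.0154 — 3 statements merged into one kernel-verified Lean document; each statement's English description precedes it below -/
import Mathlib

section
/- Let Ω ⊂ ℝ² be a convex body with diam(Ω) = 2, β > 0, and let u ∈ W^{2,2}(Ω) satisfy ∫_Ω |1−|∇u|²| |∇²u| dz ≤ β, ∫_Ω |1−|∇u|²|² dz ≤ β², u = 0 on ∂Ω and ∇u(z)·η_z = 1 on ∂Ω in the sense of trace. Let U := N_{1/10}(Ω) and let ū : U → ℝ be the extension defined by ū = u + 1/10 on closure(Ω) and ū(z) = 1/10 − d(z,Ω) on U\Ω. Let Γ ⊂ S¹ be the set from the compactness lemma (satisfying H¹(S¹\Γ) ≤ cβ^{1/8}, −Γ = Γ, and for each θ ∈ Γ there is w_θ ∈ W^{1,1}(U) with ∫_U |∇w_θ − R(Λ_θ(R(∇ū)))| ≤ cβ^{1/8}). Let R be the anticlockwise rotation R(z₁,z₂) = (−z₂,z₁) and let R₀ ∈ {R, R^{-1}}. Then there is a universal constant c such that for a.e. θ ∈ Γ there exist unique points a_θ, b_θ ∈ ∂U with η_{a_θ} = θ and η_{b_θ} = −θ, and, defining G_θ^{R₀} := {z ∈ U : ∇ū(z)·R₀^{-1}θ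 > 0}, one has |U ∩ H((a_θ+b_θ)/2, R₀((b_θ−a_θ)/|b_θ−a_θ|)) \ G_θ^{R₀}| ≤ c·β^{1/24}. -/
open MeasureTheory Metric
open scoped RealInnerProductSpace ENNReal Classical

noncomputable section

abbrev E2 := EuclideanSpace ℝ (Fin 2)

/-- `η` is an inward pointing unit normal to the convex set `Ω` at the boundary point `x`. -/
def IsInwardUnitNormal (Ω : Set E2) (x η : E2) : Prop :=
  ‖η‖ = 1 ∧ ∀ z ∈ Ω, 0 ≤ ⟪η, z - x⟫

/-- The anticlockwise rotation by `π/2`: `R(z₁, z₂) = (−z₂, z₁)`. -/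
def Rot (z : E2) : E2 := (EuclideanSpace.equiv (Fin 2) ℝ).symm ![-(z 1), z 0]

/-- The inverse (clockwise) rotation `R⁻¹(z₁, z₂) = (z₂, −z₁)`. -/
def RotInv (z : E2) : E2 := (EuclideanSpace.equiv (Fin 2) ℝ).symm ![z 1, -(z 0)]

/-- `Λ_θ(z) = θ` if `z·θ > 0` and `Λ_θ(z) = 0` otherwise. -/
def lamVec (θ z : E2) : E2 := if 0 < ⟪z, θ⟫ then θ else 0

/-- The open half-plane `H(x, v) = {z : (z − x)·v > 0}`. -/
def halfPlane (x v : E2) : Set E2 := {z : E2 | 0 < ⟪z - x, v⟫}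

/-- The extension `ū` of `u` to `U = N_{1/10}(Ω)`. -/
def ubarF (r : ℝ) (Ω : Set E2) (u : E2 → ℝ) : E2 → ℝ :=
  fun z => if z ∈ closure Ω then u z + r else r - Metric.infDist z Ω

/-- `(e, f)` is an orthonormal frame of the plane. -/
structure IsFrame (e f : E2) : Prop where
  norm_fst : ‖e‖ = 1
  norm_snd : ‖f‖ = 1
  inner_eq : ⟪e, f⟫ = 0

/-- The point with coordinates `p` in the frame `(e, f)`. -/
def framePt (e f : E2) (p : ℝ × ℝ) : E2 := p.1 • e + p.2 • f

namespace IsFrame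

variable {e f : E2}

lemma symm (h : IsFrame e f) : IsFrame f e :=
  ⟨h.norm_snd, h.norm_fst, by rw [real_inner_comm]; exact h.inner_eq⟩

lemma neg_fst (h : IsFrame e f) : IsFrame (-e) f :=
  ⟨by rw [norm_neg]; exact h.norm_fst, h.norm_snd, by rw [inner_neg_left, h.inner_eq, neg_zero]⟩

lemma neg_snd (h : IsFrame e f) : IsFrame e (-f) :=
  ⟨h.norm_fst, by rw [norm_neg]; exact h.norm_snd, by rw [inner_neg_right, h.inner_eq, neg_zero]⟩

lemma inner_fst_self (h : IsFrame e f) : ⟪e, e⟫ = 1 := by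
  rw [real_inner_self_eq_norm_sq, h.norm_fst]; norm_num

lemma inner_snd_self (h : IsFrame e f) : ⟪f, f⟫ = 1 := by
  rw [real_inner_self_eq_norm_sq, h.norm_snd]; norm_num

lemma inner_eq' (h : IsFrame e f) : ⟪f, e⟫ = 0 := h.symm.inner_eq

lemma orthonormal (h : IsFrame e f) : Orthonormal ℝ ![e, f] := by
  refine ⟨fun i => ?_, fun i j hij => ?_⟩
  · fin_cases i
    · exact h.norm_fst
    · exact h.norm_snd
  · fin_cases i <;> fin_cases j
    · exact absurd rfl hij
    · exact h.inner_eq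
    · exact h.inner_eq'
    · exact absurd rfl hij

/-- The orthonormal basis given by a frame. -/
def basis (h : IsFrame e f) : OrthonormalBasis (Fin 2) ℝ E2 :=
  OrthonormalBasis.mk h.orthonormal (by
    rw [h.orthonormal.linearIndependent.span_eq_top_of_card_eq_finrank (by simp)])

lemma basis_zero (h : IsFrame e f) : h.basis 0 = e := by simp [basis]

lemma basis_one (h : IsFrame e f) : h.basis 1 = f := by simp [basis]

lemma eq_add (h : IsFrame e f) (z : E2) : z = ⟪z, e⟫ • e + ⟪z, f⟫ • f := by
  have := h.basis.sum_repr z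
  rw [Fin.sum_univ_two, h.basis.repr_apply_apply, h.basis.repr_apply_apply, h.basis_zero,
    h.basis_one, real_inner_comm z e, real_inner_comm z f] at this
  exact this.symm

lemma norm_sq (h : IsFrame e f) (z : E2) : ‖z‖ ^ 2 = ⟪z, e⟫ ^ 2 + ⟪z, f⟫ ^ 2 := by
  have h1 : ‖z‖ ^ 2 = ⟪z, z⟫ := (real_inner_self_eq_norm_sq z).symm
  have h2 : ⟪z, z⟫ = ⟪z, ⟪z, e⟫ • e + ⟪z, f⟫ • f⟫ := by rw [← h.eq_add z]
  rw [h1, h2, inner_add_right, inner_smul_right, inner_smul_right]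
  ring

lemma inner_eq_add (h : IsFrame e f) (z w : E2) :
    ⟪z, w⟫ = ⟪z, e⟫ * ⟪w, e⟫ + ⟪z, f⟫ * ⟪w, f⟫ := by
  conv_lhs => rw [h.eq_add w]
  rw [inner_add_right, inner_smul_right, inner_smul_right]
  ring

lemma inner_framePt_fst (h : IsFrame e f) (p : ℝ × ℝ) : ⟪framePt e f p, e⟫ = p.1 := by
  simp [framePt, inner_add_left, inner_smul_left, h.inner_eq', h.norm_fst]

lemma inner_framePt_snd (h : IsFrame e f) (p : ℝ × ℝ) : ⟪framePt e f p, f⟫ = p.2 := by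
  simp [framePt, inner_add_left, inner_smul_left, h.inner_eq, h.norm_snd]

lemma framePt_inner (h : IsFrame e f) (z : E2) : framePt e f (⟪z, e⟫, ⟪z, f⟫) = z :=
  (h.eq_add z).symm

/-- The coordinates of a frame as a measurable equivalence. -/
def equiv (h : IsFrame e f) : E2 ≃ᵐ ℝ × ℝ :=
  (h.basis.repr.toHomeomorph.toMeasurableEquiv.trans
    (MeasurableEquiv.toLp 2 (Fin 2 → ℝ)).symm).trans MeasurableEquiv.finTwoArrow

lemma measurePreserving_equiv (h : IsFrame e f) : MeasurePreserving h.equiv volume volume :=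
  (volume_preserving_finTwoArrow ℝ).comp
    ((EuclideanSpace.volume_preserving_symm_measurableEquiv_toLp (Fin 2)).comp
      h.basis.measurePreserving_repr)

lemma equiv_apply (h : IsFrame e f) (z : E2) : h.equiv z = (⟪z, e⟫, ⟪z, f⟫) := by
  have h0 : h.equiv z = (h.basis.repr z 0, h.basis.repr z 1) := rfl
  rw [h0, h.basis.repr_apply_apply, h.basis.repr_apply_apply, h.basis_zero, h.basis_one,
    real_inner_comm z e, real_inner_comm z f]

lemma equiv_symm_apply (h : IsFrame e f) (p : ℝ × ℝ) : h.equiv.symm p = framePt e f p := by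
  rw [MeasurableEquiv.symm_apply_eq, h.equiv_apply, h.inner_framePt_fst, h.inner_framePt_snd]

lemma setIntegral_eq (h : IsFrame e f) (S : Set E2) (G : E2 → ℝ) :
    ∫ z in S, G z = ∫ p in framePt e f ⁻¹' S, G (framePt e f p) := by
  have h1 : (h.equiv.symm : ℝ × ℝ → E2) = framePt e f := funext h.equiv_symm_apply
  have := (h.measurePreserving_equiv.symm h.equiv).setIntegral_preimage_emb
    h.equiv.symm.measurableEmbedding G S
  rw [h1] at this
  exact this.symm

/-- A strip of bounded height has area at most width times height. -/
lemma volume_le (h : IsFrame e f) {S : Set E2} {x₀ x₁ y₀ y₁ : ℝ}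
    (hS : ∀ z ∈ S, ⟪z, e⟫ ∈ Set.Icc x₀ x₁ ∧ ⟪z, f⟫ ∈ Set.Icc y₀ y₁) :
    volume S ≤ ENNReal.ofReal (x₁ - x₀) * ENNReal.ofReal (y₁ - y₀) := by
  have h1 : S ⊆ h.equiv ⁻¹' (Set.Icc x₀ x₁ ×ˢ Set.Icc y₀ y₁) := by
    intro z hz
    rw [Set.mem_preimage, h.equiv_apply]
    exact Set.mk_mem_prod (hS z hz).1 (hS z hz).2
  refine (measure_mono h1).trans ?_
  rw [h.measurePreserving_equiv.measure_preimage_equiv, Measure.volume_eq_prod,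
    Measure.prod_prod, Real.volume_Icc, Real.volume_Icc]

end IsFrame

lemma continuous_framePt (e f : E2) : Continuous (framePt e f) := by
  unfold framePt; fun_prop

/-- The abscissae of the points of `Ω` in the frame `(e, f)`. -/
def shadow (Ω : Set E2) (e f : E2) : Set ℝ := {x | ∃ y, framePt e f (x, y) ∈ Ω}

/-- The lower end of the slice of `Ω` at the abscissa `x`. -/
def sliceInf (Ω : Set E2) (e f : E2) (x : ℝ) : ℝ := sInf {y | framePt e f (x, y) ∈ Ω}

/-- The upper end of the slice of `Ω` at the abscissa `x`. -/
def sliceSup (Ω : Set E2) (e f : E2) (x : ℝ) : ℝ := sSup {y | framePt e f (x, y) ∈ Ω}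

section Slices

variable {Ω : Set E2} {e f : E2}

lemma isCompact_preimage_framePt (h : IsFrame e f) (hΩ : IsCompact Ω) :
    IsCompact (framePt e f ⁻¹' Ω) := by
  have h1 : framePt e f ⁻¹' Ω = (fun z : E2 => (⟪z, e⟫, ⟪z, f⟫)) '' Ω := by
    ext p
    constructor
    · intro hp
      exact ⟨framePt e f p, hp, Prod.ext (h.inner_framePt_fst p) (h.inner_framePt_snd p)⟩
    · rintro ⟨z, hz, rfl⟩
      rw [Set.mem_preimage, h.framePt_inner]
      exact hz
  rw [h1]
  exact hΩ.image (by fun_prop)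

lemma isCompact_shadow (h : IsFrame e f) (hΩ : IsCompact Ω) : IsCompact (shadow Ω e f) := by
  have h1 : shadow Ω e f = (fun z : E2 => ⟪z, e⟫) '' Ω := by
    ext x
    constructor
    · rintro ⟨y, hy⟩
      exact ⟨_, hy, h.inner_framePt_fst _⟩
    · rintro ⟨z, hz, rfl⟩
      exact ⟨⟪z, f⟫, by rw [h.framePt_inner]; exact hz⟩
  rw [h1]
  exact hΩ.image (by fun_prop)

lemma slice_eq_Icc (h : IsFrame e f) (hΩ : IsCompact Ω) (hc : Convex ℝ Ω) {x : ℝ}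
    (hx : x ∈ shadow Ω e f) :
    {y | framePt e f (x, y) ∈ Ω} = Set.Icc (sliceInf Ω e f x) (sliceSup Ω e f x) := by
  have hcl : IsClosed {y | framePt e f (x, y) ∈ Ω} :=
    hΩ.isClosed.preimage ((continuous_framePt e f).comp (by fun_prop))
  have hsub : {y | framePt e f (x, y) ∈ Ω} ⊆ (fun z : E2 => ⟪z, f⟫) '' Ω :=
    fun y hy => ⟨_, hy, h.inner_framePt_snd _⟩
  have hcomp : IsCompact {y | framePt e f (x, y) ∈ Ω} :=
    (hΩ.image (by fun_prop)).of_isClosed_subset hcl hsub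
  have hconv : Convex ℝ {y | framePt e f (x, y) ∈ Ω} := by
    intro y hy y' hy' a b ha hb hab
    have := hc hy hy' ha hb hab
    have h2 : a • framePt e f (x, y) + b • framePt e f (x, y')
        = framePt e f (x, a • y + b • y') := by
      simp only [framePt, smul_eq_mul]
      have hb' : b = 1 - a := by linarith
      rw [hb']
      module
    rw [h2] at this
    exact this
  exact eq_Icc_of_connected_compact ⟨hx, hconv.isPreconnected⟩ hcomp

lemma sliceInf_le_sliceSup (h : IsFrame e f) (hΩ : IsCompact Ω) (hc : Convex ℝ Ω) {x : ℝ}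
    (hx : x ∈ shadow Ω e f) : sliceInf Ω e f x ≤ sliceSup Ω e f x := by
  obtain ⟨y, hy⟩ := hx
  have h1 : y ∈ Set.Icc (sliceInf Ω e f x) (sliceSup Ω e f x) := by
    rw [← slice_eq_Icc h hΩ hc ⟨y, hy⟩]; exact hy
  exact h1.1.trans h1.2

lemma framePt_sliceInf_mem (h : IsFrame e f) (hΩ : IsCompact Ω) (hc : Convex ℝ Ω) {x : ℝ}
    (hx : x ∈ shadow Ω e f) : framePt e f (x, sliceInf Ω e f x) ∈ Ω := by
  have h1 : sliceInf Ω e f x ∈ {y | framePt e f (x, y) ∈ Ω} := by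
    rw [slice_eq_Icc h hΩ hc hx]
    exact ⟨le_rfl, sliceInf_le_sliceSup h hΩ hc hx⟩
  exact h1

lemma framePt_sliceSup_mem (h : IsFrame e f) (hΩ : IsCompact Ω) (hc : Convex ℝ Ω) {x : ℝ}
    (hx : x ∈ shadow Ω e f) : framePt e f (x, sliceSup Ω e f x) ∈ Ω := by
  have h1 : sliceSup Ω e f x ∈ {y | framePt e f (x, y) ∈ Ω} := by
    rw [slice_eq_Icc h hΩ hc hx]
    exact ⟨sliceInf_le_sliceSup h hΩ hc hx, le_rfl⟩
  exact h1

lemma framePt_mem_frontier (h : IsFrame e f) (hΩ : IsCompact Ω) (hc : Convex ℝ Ω) {x y : ℝ}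
    (hx : x ∈ shadow Ω e f) (hy : y = sliceInf Ω e f x ∨ y = sliceSup Ω e f x) :
    framePt e f (x, y) ∈ frontier Ω := by
  have hmem : framePt e f (x, y) ∈ Ω := by
    rcases hy with rfl | rfl
    · exact framePt_sliceInf_mem h hΩ hc hx
    · exact framePt_sliceSup_mem h hΩ hc hx
  rw [hΩ.isClosed.frontier_eq]
  refine ⟨hmem, fun hintg => ?_⟩
  have hcont : Continuous fun y : ℝ => framePt e f (x, y) :=
    (continuous_framePt e f).comp (by fun_prop)
  have hnhds : {y | framePt e f (x, y) ∈ Ω} ∈ nhds y :=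
    hcont.continuousAt.preimage_mem_nhds (mem_interior_iff_mem_nhds.1 hintg)
  rw [slice_eq_Icc h hΩ hc hx, Icc_mem_nhds_iff] at hnhds
  rcases hy with rfl | rfl
  · exact lt_irrefl _ hnhds.1
  · exact lt_irrefl _ hnhds.2

lemma integrable_indicator_framePt (h : IsFrame e f) (hΩ : IsCompact Ω) {F : E2 → ℝ}
    (hF : ContDiff ℝ 1 F) :
    Integrable ((framePt e f ⁻¹' Ω).indicator fun p => fderiv ℝ F (framePt e f p) f)
      (volume.prod volume) := by
  have hK := isCompact_preimage_framePt h hΩ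
  have h1 : Continuous (fderiv ℝ F) := hF.continuous_fderiv one_ne_zero
  have h2 : Continuous fun p => fderiv ℝ F (framePt e f p) f :=
    (h1.comp (continuous_framePt e f)).clm_apply continuous_const
  exact (integrable_indicator_iff hK.measurableSet).2 (h2.continuousOn.integrableOn_compact hK)

lemma integral_slice_eq (h : IsFrame e f) (hΩ : IsCompact Ω) (hc : Convex ℝ Ω)
    {F : E2 → ℝ} (hF : ContDiff ℝ 1 F) (x : ℝ) :
    ∫ y, (framePt e f ⁻¹' Ω).indicator (fun p => fderiv ℝ F (framePt e f p) f) (x, y) =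
      (shadow Ω e f).indicator (fun x => F (framePt e f (x, sliceSup Ω e f x)) -
        F (framePt e f (x, sliceInf Ω e f x))) x := by
  set K : Set (ℝ × ℝ) := framePt e f ⁻¹' Ω with hK
  set G : ℝ × ℝ → ℝ := fun p => fderiv ℝ F (framePt e f p) f with hG
  have hGc : Continuous G := by
    have h1 : Continuous (fderiv ℝ F) := hF.continuous_fderiv one_ne_zero
    exact (h1.comp (continuous_framePt e f)).clm_apply continuous_const
  by_cases hx : x ∈ shadow Ω e f
  · rw [Set.indicator_of_mem hx]
    have h1 : (fun y => K.indicator G (x, y)) =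
        (Set.Icc (sliceInf Ω e f x) (sliceSup Ω e f x)).indicator (fun y => G (x, y)) := by
      rw [← slice_eq_Icc h hΩ hc hx]
      rfl
    have hle := sliceInf_le_sliceSup h hΩ hc hx
    rw [h1, integral_indicator measurableSet_Icc, integral_Icc_eq_integral_Ioc,
      ← intervalIntegral.integral_of_le hle]
    refine intervalIntegral.integral_eq_sub_of_hasDerivAt
      (f := fun y => F (framePt e f (x, y))) (fun y _ => ?_)
      ((hGc.comp (Continuous.prodMk_right x)).intervalIntegrable _ _)
    have hdF : Differentiable ℝ F := hF.differentiable one_ne_zero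
    have hd : HasFDerivAt F (fderiv ℝ F (framePt e f (x, y))) (framePt e f (x, y)) :=
      (hdF _).hasFDerivAt
    have hl : HasDerivAt (fun y : ℝ => framePt e f (x, y)) f y := by
      have := ((hasDerivAt_id y).smul_const f).const_add (x • e)
      simpa [framePt] using this
    exact hd.comp_hasDerivAt y hl
  · rw [Set.indicator_of_notMem hx]
    have h1 : (fun y => K.indicator G (x, y)) = fun _ => 0 := by
      ext y
      have hn : (x, y) ∉ K := fun hy => hx ⟨y, hy⟩
      exact Set.indicator_of_notMem hn G
    rw [h1, integral_zero]

/-- Slicing form of the divergence theorem on a compact convex set. -/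
lemma setIntegral_fderiv_eq (h : IsFrame e f) (hΩ : IsCompact Ω) (hc : Convex ℝ Ω)
    {F : E2 → ℝ} (hF : ContDiff ℝ 1 F) :
    ∫ z in Ω, fderiv ℝ F z f = ∫ x in shadow Ω e f,
      (F (framePt e f (x, sliceSup Ω e f x)) - F (framePt e f (x, sliceInf Ω e f x))) := by
  rw [h.setIntegral_eq, ← integral_indicator (isCompact_preimage_framePt h hΩ).measurableSet,
    Measure.volume_eq_prod, integral_prod _ (integrable_indicator_framePt h hΩ hF),
    ← integral_indicator (isCompact_shadow h hΩ).measurableSet]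
  exact integral_congr_ae (Filter.Eventually.of_forall fun x => integral_slice_eq h hΩ hc hF x)

lemma integrableOn_slice_sub (h : IsFrame e f) (hΩ : IsCompact Ω) (hc : Convex ℝ Ω)
    {F : E2 → ℝ} (hF : ContDiff ℝ 1 F) :
    IntegrableOn (fun x => F (framePt e f (x, sliceSup Ω e f x)) -
      F (framePt e f (x, sliceInf Ω e f x))) (shadow Ω e f) := by
  rw [← integrable_indicator_iff (isCompact_shadow h hΩ).measurableSet]
  refine (integrable_indicator_framePt h hΩ hF).integral_prod_left.congr
    (Filter.Eventually.of_forall fun x => ?_)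
  exact integral_slice_eq h hΩ hc hF x

lemma sliceInf_lt_sliceSup (h : IsFrame e f) (hΩ : IsCompact Ω) (hc : Convex ℝ Ω) {z : E2}
    (hz : z ∈ interior Ω) : sliceInf Ω e f ⟪z, e⟫ < sliceSup Ω e f ⟪z, e⟫ := by
  have hcont : Continuous fun y : ℝ => framePt e f (⟪z, e⟫, y) :=
    (continuous_framePt e f).comp (by fun_prop)
  have hx : ⟪z, e⟫ ∈ shadow Ω e f :=
    ⟨⟪z, f⟫, by rw [h.framePt_inner]; exact interior_subset hz⟩
  have hnhds : {y | framePt e f (⟪z, e⟫, y) ∈ Ω} ∈ nhds ⟪z, f⟫ := by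
    refine hcont.continuousAt.preimage_mem_nhds ?_
    rw [h.framePt_inner]
    exact mem_interior_iff_mem_nhds.1 hz
  rw [slice_eq_Icc h hΩ hc hx, Icc_mem_nhds_iff] at hnhds
  exact hnhds.1.trans hnhds.2

/-- Every abscissa strictly between those of two points of a convex body is the abscissa of an
interior point. -/
lemma exists_mem_interior_inner_eq (hc : Convex ℝ Ω) (hne : (interior Ω).Nonempty) {a b : E2}
    (ha : a ∈ Ω) (hb : b ∈ Ω) {x : ℝ} (hbx : ⟪b, e⟫ < x) (hxa : x < ⟪a, e⟫) :
    ∃ z ∈ interior Ω, ⟪z, e⟫ = x := by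
  have hcl : Ω ⊆ closure (interior Ω) := by
    rw [hc.closure_interior_eq_closure_of_nonempty_interior hne]
    exact subset_closure
  have hcont : Continuous fun z : E2 => ⟪z, e⟫ := by fun_prop
  obtain ⟨a', ha', hia⟩ := mem_closure_iff.1 (hcl ha) _ (isOpen_lt continuous_const hcont) hxa
  obtain ⟨b', hb', hib⟩ := mem_closure_iff.1 (hcl hb) _ (isOpen_lt hcont continuous_const) hbx
  have hpre := (hc.interior.isPreconnected.image _ hcont.continuousOn).ordConnected
  exact hpre.out ⟨b', hib, rfl⟩ ⟨a', hia, rfl⟩ ⟨le_of_lt hb', le_of_lt ha'⟩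

end Slices

/-- A tent function of width `s ^ 2`. -/
def tent (s t : ℝ) : ℝ := max 0 (1 - |t| / s ^ 2)

/-- A smoothed (unnormalised) Heaviside function at scale `s`. -/
def stepEntropy (s x : ℝ) : ℝ := ∫ t in (-s)..x, tent s (t ^ 2)

/-- The companion of `stepEntropy`: the field `(-sideEntropy N₂, stepEntropy N₁)` has small
divergence for every curl-free field `N` of nearly unit length. -/
def sideEntropy (s y : ℝ) : ℝ := ∫ t in (0)..y, tent s (1 - t ^ 2)

section Entropy

variable {s : ℝ}

lemma continuous_tent : Continuous (tent s) := by
  unfold tent; fun_prop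

lemma tent_nonneg (t : ℝ) : 0 ≤ tent s t := le_max_left _ _

lemma tent_le_one (t : ℝ) : tent s t ≤ 1 := by
  refine max_le zero_le_one ?_
  have : 0 ≤ |t| / s ^ 2 := by positivity
  linarith

lemma tent_eq_zero (hs : 0 < s) {t : ℝ} (ht : s ^ 2 ≤ |t|) : tent s t = 0 := by
  refine max_eq_left ?_
  have : 1 ≤ |t| / s ^ 2 := by rw [le_div_iff₀ (by positivity)]; linarith
  linarith

lemma abs_tent_sub_le (a b : ℝ) : |tent s a - tent s b| ≤ |a - b| / s ^ 2 := by
  have h1 : |tent s a - tent s b| ≤ |(1 - |a| / s ^ 2) - (1 - |b| / s ^ 2)| := by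
    unfold tent
    rw [max_comm, max_comm (0 : ℝ)]
    exact abs_max_sub_max_le_abs _ _ _
  have h2 : (1 - |a| / s ^ 2) - (1 - |b| / s ^ 2) = (|b| - |a|) / s ^ 2 := by ring
  rw [h2, abs_div, abs_of_nonneg (sq_nonneg s)] at h1
  refine h1.trans ?_
  refine div_le_div_of_nonneg_right ?_ (sq_nonneg s)
  rw [abs_sub_comm a b]
  exact abs_abs_sub_abs_le b a

lemma continuous_tent_sq : Continuous fun t : ℝ => tent s (t ^ 2) :=
  continuous_tent.comp (by fun_prop)

lemma continuous_tent_one_sub_sq : Continuous fun t : ℝ => tent s (1 - t ^ 2) :=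
  continuous_tent.comp (by fun_prop)

lemma hasDerivAt_stepEntropy (x : ℝ) : HasDerivAt (stepEntropy s) (tent s (x ^ 2)) x :=
  continuous_tent_sq.integral_hasStrictDerivAt _ _ |>.hasDerivAt

lemma hasDerivAt_sideEntropy (y : ℝ) : HasDerivAt (sideEntropy s) (tent s (1 - y ^ 2)) y :=
  continuous_tent_one_sub_sq.integral_hasStrictDerivAt _ _ |>.hasDerivAt

lemma contDiff_stepEntropy : ContDiff ℝ 1 (stepEntropy s) := by
  rw [contDiff_one_iff_deriv]
  refine ⟨fun x => (hasDerivAt_stepEntropy x).differentiableAt, ?_⟩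
  rw [show deriv (stepEntropy s) = _ from funext fun x => (hasDerivAt_stepEntropy x).deriv]
  exact continuous_tent_sq

lemma contDiff_sideEntropy : ContDiff ℝ 1 (sideEntropy s) := by
  rw [contDiff_one_iff_deriv]
  refine ⟨fun x => (hasDerivAt_sideEntropy x).differentiableAt, ?_⟩
  rw [show deriv (sideEntropy s) = _ from funext fun x => (hasDerivAt_sideEntropy x).deriv]
  exact continuous_tent_one_sub_sq

lemma stepEntropy_sub (x y : ℝ) :
    stepEntropy s y - stepEntropy s x = ∫ t in x..y, tent s (t ^ 2) :=
  intervalIntegral.integral_interval_sub_left (continuous_tent_sq.intervalIntegrable _ _)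
    (continuous_tent_sq.intervalIntegrable _ _)

lemma monotone_stepEntropy : Monotone (stepEntropy s) := by
  intro x y hxy
  have h1 : 0 ≤ ∫ t in x..y, tent s (t ^ 2) :=
    intervalIntegral.integral_nonneg hxy fun t _ => tent_nonneg _
  linarith [stepEntropy_sub (s := s) x y]

lemma tent_sq_eq_zero (hs : 0 < s) {t : ℝ} (ht : s ≤ |t|) : tent s (t ^ 2) = 0 := by
  refine tent_eq_zero hs ?_
  rw [abs_of_nonneg (sq_nonneg t), ← sq_abs t]
  gcongr

lemma stepEntropy_eq_zero (hs : 0 < s) {x : ℝ} (hx : x ≤ -s) : stepEntropy s x = 0 := by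
  unfold stepEntropy
  rw [intervalIntegral.integral_congr (g := fun _ => 0), intervalIntegral.integral_zero]
  intro t ht
  rw [Set.uIcc_of_ge hx] at ht
  exact tent_sq_eq_zero hs (by rw [abs_of_nonpos (by linarith [ht.2])]; linarith [ht.2])

lemma stepEntropy_nonneg (hs : 0 < s) (x : ℝ) : 0 ≤ stepEntropy s x := by
  rcases le_total x (-s) with h | h
  · exact (stepEntropy_eq_zero hs h).ge
  · rw [← stepEntropy_eq_zero hs (le_refl (-s))]
    exact monotone_stepEntropy h

lemma stepEntropy_eq_top (hs : 0 < s) {x : ℝ} (hx : s ≤ x) :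
    stepEntropy s x = stepEntropy s s := by
  have h1 := stepEntropy_sub (s := s) s x
  rw [intervalIntegral.integral_congr (g := fun _ => 0), intervalIntegral.integral_zero] at h1
  · linarith
  · intro t ht
    rw [Set.uIcc_of_le hx] at ht
    exact tent_sq_eq_zero hs (ht.1.trans (le_abs_self t))

lemma stepEntropy_le_top (hs : 0 < s) (x : ℝ) : stepEntropy s x ≤ stepEntropy s s := by
  rcases le_total x s with h | h
  · exact monotone_stepEntropy h
  · exact (stepEntropy_eq_top hs h).le

lemma le_stepEntropy (hs : 0 < s) {x : ℝ} (hx : 0 ≤ x) : 3 * s / 8 ≤ stepEntropy s x := by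
  have h1 : stepEntropy s 0 - stepEntropy s (-(s / 2)) = _ := stepEntropy_sub _ _
  have h2 : (∫ _ in (-(s / 2))..0, (3 / 4 : ℝ)) ≤ ∫ t in (-(s / 2))..0, tent s (t ^ 2) := by
    refine intervalIntegral.integral_mono_on (by linarith)
      (continuous_const.intervalIntegrable _ _)
      (continuous_tent_sq.intervalIntegrable _ _) fun t ht => ?_
    refine le_max_of_le_right ?_
    have h3 : |t ^ 2| / s ^ 2 ≤ 1 / 4 := by
      rw [abs_of_nonneg (sq_nonneg t), div_le_iff₀ (by positivity)]
      nlinarith [ht.1, ht.2]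
    linarith
  rw [intervalIntegral.integral_const, smul_eq_mul] at h2
  have h4 := stepEntropy_nonneg hs (-(s / 2))
  have h5 : stepEntropy s 0 ≤ stepEntropy s x := monotone_stepEntropy hx
  linarith

lemma abs_sideEntropy_le (hs : 0 < s) (y : ℝ) : |sideEntropy s y| ≤ 2 * s ^ 2 := by
  have key : ∀ σ : ℝ, (∀ t ∈ Set.uIoc 0 y, |1 - t ^ 2| < s ^ 2 → |t - σ| ≤ s ^ 2) →
      |sideEntropy s y| ≤ 2 * s ^ 2 := by
    intro σ hσ
    have h1 : |sideEntropy s y| ≤ ∫ t in Set.uIoc 0 y, |tent s (1 - t ^ 2)| := by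
      unfold sideEntropy
      simp only [← Real.norm_eq_abs]
      exact intervalIntegral.norm_integral_le_integral_norm_uIoc
    set J : Set ℝ := Set.Icc (σ - s ^ 2) (σ + s ^ 2) with hJ
    have hJi : Integrable (J.indicator fun _ => (1 : ℝ)) volume :=
      (integrable_indicator_iff measurableSet_Icc).2 (by simp)
    have h2 : ∫ t in Set.uIoc 0 y, |tent s (1 - t ^ 2)| ≤
        ∫ t in Set.uIoc 0 y, J.indicator (fun _ => (1 : ℝ)) t := by
      refine setIntegral_mono_on ?_ hJi.integrableOn measurableSet_uIoc fun t ht => ?_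
      · exact ((continuous_tent_one_sub_sq.abs.integrableOn_uIcc).mono_set
          Set.uIoc_subset_uIcc)
      · rw [abs_of_nonneg (tent_nonneg _)]
        by_cases h3 : |1 - t ^ 2| < s ^ 2
        · have h4 : t ∈ J := by
            have := abs_le.1 (hσ t ht h3)
            exact ⟨by linarith [this.1], by linarith [this.2]⟩
          rw [Set.indicator_of_mem h4]
          exact tent_le_one _
        · rw [tent_eq_zero hs (not_lt.1 h3)]
          exact Set.indicator_nonneg (fun _ _ => zero_le_one) t
    have h3 : ∫ t in Set.uIoc 0 y, J.indicator (fun _ => (1 : ℝ)) t ≤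
        ∫ t, J.indicator (fun _ => (1 : ℝ)) t :=
      setIntegral_le_integral hJi
        (Filter.Eventually.of_forall fun t => Set.indicator_nonneg (fun _ _ => zero_le_one) t)
    have h4 : ∫ t, J.indicator (fun _ => (1 : ℝ)) t = 2 * s ^ 2 := by
      rw [integral_indicator measurableSet_Icc]
      simp
      rw [max_eq_left (by nlinarith [sq_nonneg s])]
      ring
    linarith
  rcases le_total 0 y with hy | hy
  · refine key 1 fun t ht h => ?_
    rw [Set.uIoc_of_le hy] at ht
    have h1 : |t - 1| * 1 ≤ |t - 1| * (t + 1) := by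
      have := abs_nonneg (t - 1)
      gcongr
      linarith [ht.1]
    have h2 : |1 - t ^ 2| = |t - 1| * (t + 1) := by
      have h0 : 0 ≤ t + 1 := by linarith [ht.1]
      rw [abs_sub_comm, show t ^ 2 - 1 = (t - 1) * (t + 1) by ring, abs_mul, abs_of_nonneg h0]
    linarith
  · refine key (-1) fun t ht h => ?_
    rw [Set.uIoc_of_ge hy] at ht
    have h1 : |t - -1| * 1 ≤ |t - -1| * (1 - t) := by
      have := abs_nonneg (t - -1)
      gcongr
      linarith [ht.2]
    have h2 : |1 - t ^ 2| = |t - -1| * (1 - t) := by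
      have h0 : 0 ≤ 1 - t := by linarith [ht.2]
      rw [show 1 - t ^ 2 = (t - -1) * (1 - t) by ring, abs_mul, abs_of_nonneg h0]
    linarith

end Entropy

section Estimate

variable {u : E2 → ℝ} {e f : E2}

lemma inner_gradient (v z : E2) : ⟪gradient u z, v⟫ = fderiv ℝ u z v :=
  InnerProductSpace.toDual_symm_apply

lemma contDiff_inner_gradient (hu : ContDiff ℝ 2 u) (v : E2) :
    ContDiff ℝ 1 fun z => ⟪gradient u z, v⟫ := by
  simp only [inner_gradient]
  exact (hu.fderiv_right (m := 1) (by norm_num)).clm_apply contDiff_const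

lemma contDiff_gradient (hu : ContDiff ℝ 2 u) (h : IsFrame e f) : ContDiff ℝ 1 (gradient u) := by
  have h1 : gradient u = fun z => ⟪gradient u z, e⟫ • e + ⟪gradient u z, f⟫ • f :=
    funext fun z => h.eq_add _
  rw [h1]
  exact ((contDiff_inner_gradient hu e).smul contDiff_const).add
    ((contDiff_inner_gradient hu f).smul contDiff_const)

lemma fderiv_inner_gradient_comm (hu : ContDiff ℝ 2 u) (v w z : E2) :
    fderiv ℝ (fun z => ⟪gradient u z, v⟫) z w = fderiv ℝ (fun z => ⟪gradient u z, w⟫) z v := by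
  have hd : Differentiable ℝ (fderiv ℝ u) :=
    (hu.fderiv_right (m := 1) (by norm_num)).differentiable one_ne_zero
  have hud : Differentiable ℝ u := hu.differentiable two_ne_zero
  have h1 : ∀ v w : E2, fderiv ℝ (fun z => ⟪gradient u z, v⟫) z w
      = fderiv ℝ (fderiv ℝ u) z w v := by
    intro v w
    simp only [inner_gradient]
    rw [fderiv_clm_apply (hd z) (differentiableAt_const v)]
    simp
  rw [h1, h1]
  exact second_derivative_symmetric (fun y => (hud y).hasFDerivAt) (hd z).hasFDerivAt w v

lemma abs_fderiv_inner_gradient_le (hu : ContDiff ℝ 2 u) (h : IsFrame e f) (z : E2) :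
    |fderiv ℝ (fun z => ⟪gradient u z, e⟫) z f| ≤ ‖fderiv ℝ (gradient u) z‖ := by
  have hd : Differentiable ℝ (gradient u) := (contDiff_gradient hu h).differentiable one_ne_zero
  rw [fderiv_inner_apply ℝ (hd z) (differentiableAt_const e)]
  simp only [fderiv_fun_const, Pi.zero_apply, zero_apply, inner_zero_right,
    zero_add]
  calc |⟪fderiv ℝ (gradient u) z f, e⟫| ≤ ‖fderiv ℝ (gradient u) z f‖ * ‖e‖ :=
        abs_real_inner_le_norm _ _
    _ ≤ ‖fderiv ℝ (gradient u) z‖ * ‖f‖ * ‖e‖ := by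
        gcongr
        exact ContinuousLinearMap.le_opNorm _ _
    _ = ‖fderiv ℝ (gradient u) z‖ := by rw [h.norm_fst, h.norm_snd]; ring

/-- The basic entropy estimate, in sliced form. -/
lemma abs_boundary_sub_le {Ω K : Set E2} {s m n : ℝ} (hu : ContDiff ℝ 2 u) (h : IsFrame e f)
    (hs : 0 < s) (hΩ : IsCompact Ω) (hK : IsCompact K) (hKc : Convex ℝ K) (hKΩ : K ⊆ Ω)
    (henergy : (∫ z in Ω, |1 - ‖gradient u z‖ ^ 2| * ‖fderiv ℝ (gradient u) z‖) ≤ s ^ 4)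
    (hw : ∀ z ∈ K, |m * ⟪z, f⟫ + n| ≤ 2) (hsh : volume (shadow K f e) ≤ ENNReal.ofReal 2) :
    |(∫ x in shadow K e f,
        ((m * sliceSup K e f x + n) *
          stepEntropy s ⟪gradient u (framePt e f (x, sliceSup K e f x)), e⟫ -
        (m * sliceInf K e f x + n) *
          stepEntropy s ⟪gradient u (framePt e f (x, sliceInf K e f x)), e⟫)) -
      m * ∫ z in K, stepEntropy s ⟪gradient u z, e⟫| ≤ 18 * s ^ 2 := by
  set P : E2 → ℝ := fun z => ⟪gradient u z, e⟫ with hP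
  set Q : E2 → ℝ := fun z => ⟪gradient u z, f⟫ with hQ
  set ξ : E2 → ℝ := fun z => m * ⟪z, f⟫ + n with hξ
  have hPc : ContDiff ℝ 1 P := contDiff_inner_gradient hu e
  have hQc : ContDiff ℝ 1 Q := contDiff_inner_gradient hu f
  have hξc : ContDiff ℝ 1 ξ :=
    (contDiff_const.mul (contDiff_id.inner ℝ contDiff_const)).add contDiff_const
  have hPd : Differentiable ℝ P := hPc.differentiable one_ne_zero
  have hQd : Differentiable ℝ Q := hQc.differentiable one_ne_zero
  have hξ' : ∀ z : E2, HasFDerivAt ξ (m • innerSL ℝ f) z := by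
    intro z
    have h1 : ξ = fun z => m * (innerSL ℝ f z) + n := by
      ext z
      simp only [hξ, innerSL_apply_apply, real_inner_comm]
    rw [h1]
    exact (((innerSL ℝ f).hasFDerivAt).const_mul m).add_const n
  set F : E2 → ℝ := fun z => ξ z * stepEntropy s (P z) with hF
  set G : E2 → ℝ := fun z => ξ z * sideEntropy s (Q z) with hG
  have hFc : ContDiff ℝ 1 F := hξc.mul (contDiff_stepEntropy.comp hPc)
  have hGc : ContDiff ℝ 1 G := hξc.mul (contDiff_sideEntropy.comp hQc)
  have hF' : ∀ z, fderiv ℝ F z f =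
      m * stepEntropy s (P z) + ξ z * (tent s (P z ^ 2) * fderiv ℝ P z f) := by
    intro z
    have h1 := (hξ' z).mul
      ((hasDerivAt_stepEntropy (s := s) (P z)).comp_hasFDerivAt z (hPd z).hasFDerivAt)
    have h2 : fderiv ℝ F z = _ := h1.fderiv
    rw [h2]
    simp [h.norm_snd]
    ring
  have hG' : ∀ z, fderiv ℝ G z e = ξ z * (tent s (1 - Q z ^ 2) * fderiv ℝ P z f) := by
    intro z
    have h1 := (hξ' z).mul
      ((hasDerivAt_sideEntropy (s := s) (Q z)).comp_hasFDerivAt z (hQd z).hasFDerivAt)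
    have h2 : fderiv ℝ G z = _ := h1.fderiv
    have h3 : fderiv ℝ Q z e = fderiv ℝ P z f := fderiv_inner_gradient_comm hu f e z
    rw [h2]
    simp [h.inner_eq', h3]
  have hIF := setIntegral_fderiv_eq h hK hKc hFc
  have hIG := setIntegral_fderiv_eq h.symm hK hKc hGc
  have hFi : IntegrableOn (fun z => fderiv ℝ F z f) K := by
    have h1 : Continuous (fderiv ℝ F) := hFc.continuous_fderiv one_ne_zero
    exact (h1.clm_apply continuous_const).continuousOn.integrableOn_compact hK
  have hGi : IntegrableOn (fun z => fderiv ℝ G z e) K := by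
    have h1 : Continuous (fderiv ℝ G) := hGc.continuous_fderiv one_ne_zero
    exact (h1.clm_apply continuous_const).continuousOn.integrableOn_compact hK
  have hHi : IntegrableOn (fun z => m * stepEntropy s (P z)) K :=
    (continuous_const.mul
      (contDiff_stepEntropy.continuous.comp hPc.continuous)).continuousOn.integrableOn_compact hK
  have hEc : Continuous fun z => |1 - ‖gradient u z‖ ^ 2| * ‖fderiv ℝ (gradient u) z‖ := by
    have h1 := contDiff_gradient hu h
    have h2 : Continuous (fderiv ℝ (gradient u)) := h1.continuous_fderiv one_ne_zero
    have h3 := h1.continuous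
    fun_prop
  have hdiff : |(∫ z in K, fderiv ℝ F z f) - (∫ z in K, fderiv ℝ G z e) -
      m * ∫ z in K, stepEntropy s (P z)| ≤ 2 * s ^ 2 := by
    have hFGi : IntegrableOn (fun z => fderiv ℝ F z f - fderiv ℝ G z e) K := hFi.sub hGi
    rw [← integral_const_mul, ← integral_sub hFi hGi, ← integral_sub hFGi hHi]
    have hb : ∀ z ∈ K, ‖fderiv ℝ F z f - fderiv ℝ G z e - m * stepEntropy s (P z)‖ ≤
        2 / s ^ 2 * (|1 - ‖gradient u z‖ ^ 2| * ‖fderiv ℝ (gradient u) z‖) := by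
      intro z hz
      rw [hF', hG', Real.norm_eq_abs]
      have h1 : m * stepEntropy s (P z) + ξ z * (tent s (P z ^ 2) * fderiv ℝ P z f) -
          ξ z * (tent s (1 - Q z ^ 2) * fderiv ℝ P z f) - m * stepEntropy s (P z) =
          ξ z * (tent s (P z ^ 2) - tent s (1 - Q z ^ 2)) * fderiv ℝ P z f := by ring
      rw [h1, abs_mul, abs_mul]
      have h2 : |tent s (P z ^ 2) - tent s (1 - Q z ^ 2)| ≤
          |1 - ‖gradient u z‖ ^ 2| / s ^ 2 := by
        refine (abs_tent_sub_le _ _).trans (le_of_eq ?_)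
        rw [h.norm_sq, abs_sub_comm]
        congr 2
        simp only [hP, hQ]
        ring
      calc |ξ z| * |tent s (P z ^ 2) - tent s (1 - Q z ^ 2)| * |fderiv ℝ P z f|
          ≤ 2 * (|1 - ‖gradient u z‖ ^ 2| / s ^ 2) * ‖fderiv ℝ (gradient u) z‖ := by
            gcongr
            · exact hw z hz
            · exact abs_fderiv_inner_gradient_le hu h z
        _ = _ := by ring
    calc |∫ z in K, (fderiv ℝ F z f - fderiv ℝ G z e - m * stepEntropy s (P z))|
        ≤ ∫ z in K, 2 / s ^ 2 * (|1 - ‖gradient u z‖ ^ 2| * ‖fderiv ℝ (gradient u) z‖) :=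
          norm_integral_le_of_norm_le
            ((continuous_const.mul hEc).continuousOn.integrableOn_compact hK)
            ((ae_restrict_iff' hK.measurableSet).2 (Filter.Eventually.of_forall hb))
      _ = 2 / s ^ 2 * ∫ z in K, |1 - ‖gradient u z‖ ^ 2| * ‖fderiv ℝ (gradient u) z‖ :=
          integral_const_mul _ _
      _ ≤ 2 / s ^ 2 * s ^ 4 := by
          gcongr
          refine le_trans (setIntegral_mono_set (hEc.continuousOn.integrableOn_compact hΩ)
            (Filter.Eventually.of_forall fun z => by positivity) hKΩ.eventuallyLE) henergy
      _ = 2 * s ^ 2 := by field_simp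
  have hGb : |∫ z in K, fderiv ℝ G z e| ≤ 16 * s ^ 2 := by
    have hGK : ∀ z ∈ K, |G z| ≤ 4 * s ^ 2 := by
      intro z hz
      simp only [hG]
      rw [abs_mul]
      calc |ξ z| * |sideEntropy s (Q z)| ≤ 2 * (2 * s ^ 2) := by
            gcongr
            · exact hw z hz
            · exact abs_sideEntropy_le hs _
        _ = _ := by ring
    rw [hIG]
    have h1 := norm_setIntegral_le_of_norm_le_const (μ := volume) (C := 8 * s ^ 2)
      (f := fun x => G (framePt f e (x, sliceSup K f e x)) -
        G (framePt f e (x, sliceInf K f e x)))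
      (s := shadow K f e) (hsh.trans_lt ENNReal.ofReal_lt_top) (fun x hx => by
        have h1 := hGK _ (framePt_sliceSup_mem h.symm hK hKc hx)
        have h2 := hGK _ (framePt_sliceInf_mem h.symm hK hKc hx)
        rw [Real.norm_eq_abs]
        refine (abs_sub _ _).trans ?_
        linarith)
    have h2 : volume.real (shadow K f e) ≤ 2 := by
      rw [Measure.real]
      exact ENNReal.toReal_le_of_le_ofReal (by norm_num) hsh
    calc _ ≤ 8 * s ^ 2 * volume.real (shadow K f e) := h1
      _ ≤ 8 * s ^ 2 * 2 := by gcongr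
      _ = _ := by ring
  rw [hIF] at hdiff
  simp only [hF, hξ, h.inner_framePt_snd] at hdiff
  have h1 := abs_le.1 hdiff
  have h2 := abs_le.1 hGb
  rw [abs_le]
  constructor <;> linarith [h1.1, h1.2, h2.1, h2.2]

end Estimate

/-- The point `a` of `Ω` minimises the linear functional `⟪n, ·⟫` on `Ω`. -/
def IsMinPt (Ω : Set E2) (n a : E2) : Prop := a ∈ Ω ∧ ∀ z ∈ Ω, ⟪n, a⟫ ≤ ⟪n, z⟫

/-- The hypotheses on a convex body and a function at scale `s`. -/
structure EikonalData (Ω : Set E2) (u : E2 → ℝ) (s : ℝ) : Prop where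
  contDiff : ContDiff ℝ 2 u
  convex : Convex ℝ Ω
  isCompact : IsCompact Ω
  nonempty : (interior Ω).Nonempty
  diam_eq : Metric.diam Ω = 2
  pos : 0 < s
  energy : (∫ z in Ω, |1 - ‖gradient u z‖ ^ 2| * ‖fderiv ℝ (gradient u) z‖) ≤ s ^ 4
  normal : ∀ x ∈ frontier Ω, IsInwardUnitNormal Ω x (gradient u x)

section Geometry

variable {Ω K : Set E2} {u : E2 → ℝ} {s τ : ℝ} {e f : E2}

lemma exists_isMinPt (hΩ : IsCompact Ω) (hne : (interior Ω).Nonempty) (n : E2) :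
    ∃ a, IsMinPt Ω n a := by
  obtain ⟨a, ha, hmin⟩ := hΩ.exists_isMinOn (hne.mono interior_subset)
    (f := fun z : E2 => ⟪n, z⟫) (by fun_prop)
  exact ⟨a, ha, fun z hz => hmin hz⟩

/-- To the right of the point with normal `-s e + τ f`, normals are steeper. -/
lemma IsInwardUnitNormal.inner_le_neg (h : IsFrame e f) (hs : 0 < s) (hτ : 0 < τ)
    (hsτ : s ^ 2 + τ ^ 2 = 1) {a q N : E2} (ha : IsMinPt Ω (-s • e + τ • f) a) (hq : q ∈ Ω)
    (hN : IsInwardUnitNormal Ω q N) (haq : ⟪a, e⟫ < ⟪q, e⟫) (hNf : 0 ≤ ⟪N, f⟫) :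
    ⟪N, e⟫ ≤ -s := by
  have h1 := hN.2 a ha.1
  rw [h.inner_eq_add, inner_sub_left, inner_sub_left] at h1
  have h2 := ha.2 q hq
  rw [inner_add_left, inner_add_left, inner_smul_left, inner_smul_left, inner_smul_left,
    inner_smul_left, real_inner_comm a e, real_inner_comm a f, real_inner_comm q e,
    real_inner_comm q f] at h2
  simp only [conj_trivial] at h2
  have h3 := h.norm_sq N
  rw [hN.1] at h3
  have hdx : 0 < ⟪q, e⟫ - ⟪a, e⟫ := by linarith
  set p := ⟪N, e⟫
  set r := ⟪N, f⟫
  have h4 : s * (⟪q, e⟫ - ⟪a, e⟫) ≤ τ * (⟪q, f⟫ - ⟪a, f⟫) := by linarith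
  have h5 : τ * p + r * s ≤ 0 := by
    by_contra hcon
    push Not at hcon
    have h6 : 0 < (τ * p + r * s) * (⟪q, e⟫ - ⟪a, e⟫) := by positivity
    have h7 := mul_le_mul_of_nonneg_left h4 hNf
    have h8 : 0 ≤ τ * (p * (⟪a, e⟫ - ⟪q, e⟫) + r * (⟪a, f⟫ - ⟪q, f⟫)) := by positivity
    nlinarith
  by_contra hcon
  push Not at hcon
  have hp : p ≤ 0 := by nlinarith [mul_nonneg hNf hs.le]
  have h6 : p ^ 2 < s ^ 2 := by nlinarith
  have h7 : τ < r := by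
    by_contra h8
    push Not at h8
    nlinarith
  nlinarith

lemma abs_inner_sub_le (hD : EikonalData Ω u s) {z w v : E2} (hz : z ∈ Ω) (hw : w ∈ Ω)
    (hv : ‖v‖ = 1) : |⟪z, v⟫ - ⟪w, v⟫| ≤ 2 := by
  rw [← inner_sub_left]
  calc |⟪z - w, v⟫| ≤ ‖z - w‖ * ‖v‖ := abs_real_inner_le_norm _ _
    _ ≤ 2 := by
      rw [hv, mul_one, ← dist_eq_norm, ← hD.diam_eq]
      exact dist_le_diam_of_mem hD.isCompact.isBounded hz hw

lemma volume_shadow_le (hD : EikonalData Ω u s) (h : IsFrame e f) (hK : K ⊆ Ω) :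
    volume (shadow K f e) ≤ ENNReal.ofReal 2 := by
  refine (Real.volume_le_diam _).trans (Metric.ediam_le fun x hx y hy => ?_)
  obtain ⟨x', hx'⟩ := hx
  obtain ⟨y', hy'⟩ := hy
  have h1 := abs_inner_sub_le hD (hK hx') (hK hy') h.norm_snd
  rw [h.symm.inner_framePt_fst, h.symm.inner_framePt_fst] at h1
  rw [edist_dist, Real.dist_eq]
  exact ENNReal.ofReal_le_ofReal h1

lemma inner_gradient_sliceInf_nonneg (hD : EikonalData Ω u s) (h : IsFrame e f) {x : ℝ}
    (hx : x ∈ shadow Ω e f) (hlt : sliceInf Ω e f x < sliceSup Ω e f x) :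
    0 ≤ ⟪gradient u (framePt e f (x, sliceInf Ω e f x)), f⟫ := by
  have h1 := (hD.normal _ (framePt_mem_frontier h hD.isCompact hD.convex hx (Or.inl rfl))).2 _
    (framePt_sliceSup_mem h hD.isCompact hD.convex hx)
  rw [h.inner_eq_add, inner_sub_left, inner_sub_left, h.inner_framePt_fst, h.inner_framePt_snd,
    h.inner_framePt_fst, h.inner_framePt_snd, sub_self, mul_zero, zero_add] at h1
  exact nonneg_of_mul_nonneg_left h1 (sub_pos.2 hlt)

lemma inner_gradient_sliceSup_nonpos (hD : EikonalData Ω u s) (h : IsFrame e f) {x : ℝ}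
    (hx : x ∈ shadow Ω e f) (hlt : sliceInf Ω e f x < sliceSup Ω e f x) :
    0 ≤ ⟪gradient u (framePt e f (x, sliceSup Ω e f x)), -f⟫ := by
  have h1 := (hD.normal _ (framePt_mem_frontier h hD.isCompact hD.convex hx (Or.inr rfl))).2 _
    (framePt_sliceInf_mem h hD.isCompact hD.convex hx)
  rw [h.inner_eq_add, inner_sub_left, inner_sub_left, h.inner_framePt_fst, h.inner_framePt_snd,
    h.inner_framePt_fst, h.inner_framePt_snd, sub_self, mul_zero, zero_add] at h1
  rw [inner_neg_right]
  nlinarith [sub_pos.2 hlt]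

lemma inner_gradient_sliceSup_le (hD : EikonalData Ω u s) (h : IsFrame e f) (hτ : 0 < τ)
    (hsτ : s ^ 2 + τ ^ 2 = 1) {b : E2} (hb : IsMinPt Ω (-s • e + τ • -f) b) {x : ℝ}
    (hx : x ∈ shadow Ω e f) (hlt : sliceInf Ω e f x < sliceSup Ω e f x) (hbx : ⟪b, e⟫ < x) :
    ⟪gradient u (framePt e f (x, sliceSup Ω e f x)), e⟫ ≤ -s :=
  (hD.normal _ (framePt_mem_frontier h hD.isCompact hD.convex hx (Or.inr rfl))).inner_le_neg
    h.neg_snd hD.pos hτ hsτ hb (framePt_sliceSup_mem h hD.isCompact hD.convex hx)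
    (by rw [h.inner_framePt_fst]; exact hbx) (inner_gradient_sliceSup_nonpos hD h hx hlt)

lemma inner_gradient_sliceInf_le (hD : EikonalData Ω u s) (h : IsFrame e f) (hτ : 0 < τ)
    (hsτ : s ^ 2 + τ ^ 2 = 1) {a : E2} (ha : IsMinPt Ω (-s • e + τ • f) a) {x : ℝ}
    (hx : x ∈ shadow Ω e f) (hlt : sliceInf Ω e f x < sliceSup Ω e f x) (hax : ⟪a, e⟫ < x) :
    ⟪gradient u (framePt e f (x, sliceInf Ω e f x)), e⟫ ≤ -s :=
  (hD.normal _ (framePt_mem_frontier h hD.isCompact hD.convex hx (Or.inl rfl))).inner_le_neg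
    h hD.pos hτ hsτ ha (framePt_sliceInf_mem h hD.isCompact hD.convex hx)
    (by rw [h.inner_framePt_fst]; exact hax) (inner_gradient_sliceInf_nonneg hD h hx hlt)

lemma le_inner_gradient_sliceInf (hD : EikonalData Ω u s) (h : IsFrame e f) (hτ : 0 < τ)
    (hsτ : s ^ 2 + τ ^ 2 = 1) {a : E2} (ha : IsMinPt Ω (s • e + τ • f) a) {x : ℝ}
    (hx : x ∈ shadow Ω e f) (hlt : sliceInf Ω e f x < sliceSup Ω e f x) (hax : x < ⟪a, e⟫) :
    s ≤ ⟪gradient u (framePt e f (x, sliceInf Ω e f x)), e⟫ := by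
  have h1 := (hD.normal _ (framePt_mem_frontier h hD.isCompact hD.convex hx
    (Or.inl rfl))).inner_le_neg h.neg_fst hD.pos hτ hsτ (a := a)
    (by rw [neg_smul_neg]; exact ha) (framePt_sliceInf_mem h hD.isCompact hD.convex hx)
    (by rw [inner_neg_right, inner_neg_right, h.inner_framePt_fst]; linarith)
    (inner_gradient_sliceInf_nonneg hD h hx hlt)
  rw [inner_neg_right] at h1
  linarith

/-- Points of the boundary with opposite normals almost face each other. -/
lemma inner_sub_le (hD : EikonalData Ω u s) (h : IsFrame e f) (hτ : 0 < τ)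
    (hsτ : s ^ 2 + τ ^ 2 = 1) {a b : E2} (ha : IsMinPt Ω (s • e + τ • f) a)
    (hb : IsMinPt Ω (-s • e + τ • -f) b) : ⟪a, e⟫ - ⟪b, e⟫ ≤ 48 * s := by
  have hs := hD.pos
  rcases le_or_gt ⟪a, e⟫ ⟪b, e⟫ with hab | hab
  · linarith
  set P : E2 → ℝ := fun z => ⟪gradient u z, e⟫ with hP
  set T := stepEntropy s s with hT
  have hTpos : 3 * s / 8 ≤ T := le_stepEntropy hs hs.le
  have hTe : ∀ x, stepEntropy s x ≤ T := stepEntropy_le_top hs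
  have hnn : ∀ x, 0 ≤ stepEntropy s x := stepEntropy_nonneg hs
  have hest := abs_boundary_sub_le (m := 0) (n := 1) hD.contDiff h hs hD.isCompact hD.isCompact
    hD.convex le_rfl hD.energy (by intro z _; norm_num) (volume_shadow_le hD h le_rfl)
  simp only [zero_mul, zero_add, one_mul, sub_zero] at hest
  have hF : ContDiff ℝ 1 fun z => stepEntropy s (P z) :=
    contDiff_stepEntropy.comp (contDiff_inner_gradient hD.contDiff e)
  have hintg := integrableOn_slice_sub h hD.isCompact hD.convex hF
  have hsub : Set.Ioo ⟪b, e⟫ ⟪a, e⟫ ⊆ shadow Ω e f := by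
    intro x hx
    obtain ⟨z, hz, rfl⟩ := exists_mem_interior_inner_eq hD.convex hD.nonempty ha.1 hb.1 hx.1 hx.2
    exact ⟨⟪z, f⟫, by rw [h.framePt_inner]; exact interior_subset hz⟩
  have hmono : ∫ x in shadow Ω e f, (stepEntropy s (P (framePt e f (x, sliceSup Ω e f x))) -
      stepEntropy s (P (framePt e f (x, sliceInf Ω e f x)))) ≤
      ∫ x in shadow Ω e f, (Set.Ioo ⟪b, e⟫ ⟪a, e⟫).indicator (fun _ => -T) x := by
    refine setIntegral_mono_on hintg
      (((integrable_indicator_iff measurableSet_Ioo).2 (by simp)).integrableOn)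
      (isCompact_shadow h hD.isCompact).measurableSet fun x hx => ?_
    rcases (sliceInf_le_sliceSup h hD.isCompact hD.convex hx).eq_or_lt with heq | hlt
    · rw [heq, sub_self, Set.indicator_of_notMem]
      intro hxx
      obtain ⟨z, hz, rfl⟩ :=
        exists_mem_interior_inner_eq hD.convex hD.nonempty ha.1 hb.1 hxx.1 hxx.2
      exact (sliceInf_lt_sliceSup h hD.isCompact hD.convex hz).ne heq
    · have htop : ⟪b, e⟫ < x → stepEntropy s (P (framePt e f (x, sliceSup Ω e f x))) = 0 :=
        fun hbx => stepEntropy_eq_zero hs (inner_gradient_sliceSup_le hD h hτ hsτ hb hx hlt hbx)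
      have hbot : x < ⟪a, e⟫ → stepEntropy s (P (framePt e f (x, sliceInf Ω e f x))) = T :=
        fun hax => stepEntropy_eq_top hs (le_inner_gradient_sliceInf hD h hτ hsτ ha hx hlt hax)
      by_cases hxx : x ∈ Set.Ioo ⟪b, e⟫ ⟪a, e⟫
      · rw [Set.indicator_of_mem hxx, htop hxx.1, hbot hxx.2, zero_sub]
      · rw [Set.indicator_of_notMem hxx]
        by_cases hbx : ⟪b, e⟫ < x
        · rw [htop hbx]
          linarith [hnn (P (framePt e f (x, sliceInf Ω e f x)))]
        · by_cases hax : x < ⟪a, e⟫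
          · rw [hbot hax]
            linarith [hTe (P (framePt e f (x, sliceSup Ω e f x)))]
          · exfalso
            linarith
  have hval : ∫ x in shadow Ω e f, (Set.Ioo ⟪b, e⟫ ⟪a, e⟫).indicator (fun _ => -T) x =
      -T * (⟪a, e⟫ - ⟪b, e⟫) := by
    rw [setIntegral_indicator measurableSet_Ioo, Set.inter_eq_right.2 hsub]
    simp [hab.le, mul_comm]
  have h1 := (abs_le.1 hest).1
  have h2 : T * (⟪a, e⟫ - ⟪b, e⟫) ≤ 18 * s ^ 2 := by
    have : -(18 * s ^ 2) ≤ -T * (⟪a, e⟫ - ⟪b, e⟫) := h1.trans (hmono.trans_eq hval)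
    linarith
  have h3 : 3 * s / 8 * (⟪a, e⟫ - ⟪b, e⟫) ≤ 18 * s ^ 2 :=
    (mul_le_mul_of_nonneg_right hTpos (sub_nonneg.2 hab.le)).trans h2
  nlinarith

/-- On the far side of the chord, the set of points with gradient pointing away is small. -/
lemma volume_le_of_lt (hD : EikonalData Ω u s) (h : IsFrame e f) (hτ : 0 < τ)
    (hsτ : s ^ 2 + τ ^ 2 = 1) {a b : E2} {c : ℝ} (ha : IsMinPt Ω (-s • e + τ • f) a)
    (hb : IsMinPt Ω (-s • e + τ • -f) b) (hac : ⟪a, e⟫ < c) (hbc : ⟪b, e⟫ < c) :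
    volume {z | z ∈ Ω ∧ c ≤ ⟪z, e⟫ ∧ 0 ≤ ⟪gradient u z, e⟫} ≤ ENNReal.ofReal (48 * s) := by
  have hs := hD.pos
  set P : E2 → ℝ := fun z => ⟪gradient u z, e⟫ with hP
  have hPc : Continuous P := (contDiff_inner_gradient hD.contDiff e).continuous
  have hinner : Continuous fun z : E2 => ⟪z, e⟫ := by fun_prop
  set K : Set E2 := Ω ∩ {z | c ≤ ⟪z, e⟫} with hKdef
  have hKΩ : K ⊆ Ω := Set.inter_subset_left
  have hK : IsCompact K := hD.isCompact.inter_right (isClosed_le continuous_const hinner)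
  have hKc : Convex ℝ K := by
    refine hD.convex.inter fun z hz w hw α β hα hβ hαβ => ?_
    simp only [Set.mem_ofPred_eq] at hz hw ⊢
    rw [inner_add_left, inner_smul_left, inner_smul_left]
    simp only [conj_trivial]
    calc c = α * c + β * c := by rw [← add_mul, hαβ, one_mul]
      _ ≤ _ := add_le_add (mul_le_mul_of_nonneg_left hz hα) (mul_le_mul_of_nonneg_left hw hβ)
  have hest := abs_boundary_sub_le (m := 1) (n := -⟪a, f⟫) hD.contDiff h hs hD.isCompact hK hKc
    hKΩ hD.energy (by
      intro z hz
      have := abs_inner_sub_le hD (hKΩ hz) ha.1 h.norm_snd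
      rwa [one_mul, ← sub_eq_add_neg]) (volume_shadow_le hD h hKΩ)
  rw [setIntegral_eq_zero_of_forall_eq_zero] at hest
  swap
  · intro x hx
    have hcx : c ≤ x := by
      obtain ⟨y, hy⟩ := hx
      have := hy.2
      rwa [Set.mem_ofPred_eq, h.inner_framePt_fst] at this
    have hxΩ : x ∈ shadow Ω e f := by
      obtain ⟨y, hy⟩ := hx
      exact ⟨y, hy.1⟩
    have hslice : {y | framePt e f (x, y) ∈ K} = {y | framePt e f (x, y) ∈ Ω} := by
      ext y
      refine ⟨fun hy => hy.1, fun hy => ⟨hy, ?_⟩⟩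
      rw [Set.mem_ofPred_eq, h.inner_framePt_fst]
      exact hcx
    have h1 : sliceSup K e f x = sliceSup Ω e f x := by unfold sliceSup; rw [hslice]
    have h2 : sliceInf K e f x = sliceInf Ω e f x := by unfold sliceInf; rw [hslice]
    rw [h1, h2]
    rcases (sliceInf_le_sliceSup h hD.isCompact hD.convex hxΩ).eq_or_lt with heq | hlt
    · rw [heq, sub_self]
    · rw [stepEntropy_eq_zero hs
          (inner_gradient_sliceSup_le hD h hτ hsτ hb hxΩ hlt (hbc.trans_le hcx)),
        stepEntropy_eq_zero hs
          (inner_gradient_sliceInf_le hD h hτ hsτ ha hxΩ hlt (hac.trans_le hcx)),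
        mul_zero, mul_zero, sub_zero]
  rw [zero_sub, abs_neg, one_mul] at hest
  have hcont : Continuous fun z => stepEntropy s (P z) := contDiff_stepEntropy.continuous.comp hPc
  set S : Set E2 := {z | z ∈ Ω ∧ c ≤ ⟪z, e⟫ ∧ 0 ≤ P z} with hS
  have hSeq : S = K ∩ {z | 0 ≤ P z} := by
    ext z
    simp only [hS, hKdef, Set.mem_inter_iff, Set.mem_ofPred_eq, and_assoc]
  have hSc : IsCompact S := by
    rw [hSeq]
    exact hK.inter_right (isClosed_le continuous_const hPc)
  have hSK : S ⊆ K := hSeq ▸ Set.inter_subset_left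
  have hfin : volume S ≠ ⊤ := hSc.measure_lt_top.ne
  have h1 : ∫ _ in S, 3 * s / 8 ≤ ∫ z in S, stepEntropy s (P z) :=
    setIntegral_mono_on (by simp [hSc.measure_lt_top])
      (hcont.continuousOn.integrableOn_compact hSc)
      hSc.measurableSet fun z hz => le_stepEntropy hs hz.2.2
  have h2 : ∫ z in S, stepEntropy s (P z) ≤ ∫ z in K, stepEntropy s (P z) :=
    setIntegral_mono_set (hcont.continuousOn.integrableOn_compact hK)
      (Filter.Eventually.of_forall fun z => stepEntropy_nonneg hs _) hSK.eventuallyLE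
  have h3 := (le_abs_self _).trans hest
  rw [setIntegral_const, smul_eq_mul] at h1
  have h4 : volume.real S * (3 * s / 8) ≤ 18 * s ^ 2 := h1.trans (h2.trans h3)
  rw [← ENNReal.ofReal_toReal hfin]
  refine ENNReal.ofReal_le_ofReal ?_
  change volume.real S ≤ _
  nlinarith

end Geometry

section Width

variable {Ω : Set E2} {u : E2 → ℝ} {s τ : ℝ} {e f : E2}

lemma IsFrame.rotate (h : IsFrame e f) (hsτ : s ^ 2 + τ ^ 2 = 1) :
    IsFrame (τ • e + s • f) (-s • e + τ • f) := by
  refine ⟨?_, ?_, ?_⟩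
  · rw [← sq_eq_sq₀ (norm_nonneg _) zero_le_one, h.norm_sq]
    simp [inner_add_left, inner_smul_left, h.inner_fst_self, h.inner_snd_self, h.inner_eq,
      h.inner_eq', -inner_self_eq_norm_sq_to_K]
    linarith
  · rw [← sq_eq_sq₀ (norm_nonneg _) zero_le_one, h.norm_sq]
    simp [inner_add_left, inner_smul_left, h.inner_fst_self, h.inner_snd_self, h.inner_eq,
      h.inner_eq', -inner_self_eq_norm_sq_to_K]
    linarith
  · simp [inner_add_left, inner_add_right, inner_smul_left, inner_smul_right, h.inner_fst_self,
      h.inner_snd_self, h.inner_eq, h.inner_eq', -inner_self_eq_norm_sq_to_K]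
    ring

lemma inner_sub_le_of_isMinPt (hD : EikonalData Ω u s) (h : IsFrame e f) (hτ : 1 / 2 ≤ τ)
    (hsτ : s ^ 2 + τ ^ 2 = 1) {a b : E2} (ha : IsMinPt Ω f a) (hb : IsMinPt Ω (-f) b) :
    ⟪a, e⟫ - ⟪b, e⟫ ≤ 100 * s := by
  have hs := hD.pos
  have h1 : s • (τ • e + s • f) + τ • (-s • e + τ • f) = f := by
    calc s • (τ • e + s • f) + τ • (-s • e + τ • f) = (s ^ 2 + τ ^ 2) • f := by module
      _ = f := by rw [hsτ, one_smul]
  have h2 : -s • (τ • e + s • f) + τ • -(-s • e + τ • f) = -f := by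
    nth_rw 3 [← h1]
    module
  have h3 := inner_sub_le hD (h.rotate hsτ) (by linarith) hsτ (a := a) (b := b)
    (by rwa [h1]) (by rwa [h2])
  simp only [inner_add_right, inner_smul_right] at h3
  have h4 := mul_le_mul_of_nonneg_left (abs_le.1 (abs_inner_sub_le hD ha.1 hb.1 h.norm_snd)).1 hs.le
  by_contra! hcon
  nlinarith

/-- Points of the boundary with opposite normals are at nearly the same abscissa. -/
lemma abs_inner_sub_le_of_isMinPt (hD : EikonalData Ω u s) (h : IsFrame e f) (hτ : 1 / 2 ≤ τ)
    (hsτ : s ^ 2 + τ ^ 2 = 1) {a b : E2} (ha : IsMinPt Ω f a) (hb : IsMinPt Ω (-f) b) :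
    |⟪a, e⟫ - ⟪b, e⟫| ≤ 100 * s := by
  have h1 := inner_sub_le_of_isMinPt hD h hτ hsτ ha hb
  have h2 := inner_sub_le_of_isMinPt hD h.neg_fst hτ hsτ ha hb
  rw [inner_neg_right, inner_neg_right] at h2
  rw [abs_le]
  constructor <;> linarith

/-- The point with normal `-s e + τ f` is not far to the right of the point with normal `-f`. -/
lemma inner_le_of_isMinPt (hD : EikonalData Ω u s) (h : IsFrame e f) (hτ : 1 / 2 ≤ τ)
    (hsτ : s ^ 2 + τ ^ 2 = 1) {a b : E2} (ha : IsMinPt Ω (-s • e + τ • f) a)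
    (hb : IsMinPt Ω (-f) b) : ⟪a, e⟫ ≤ ⟪b, e⟫ + 204 * s := by
  have hs := hD.pos
  obtain ⟨b', hb'⟩ := exists_isMinPt hD.isCompact hD.nonempty (-(-s • e + τ • f))
  have h1 := (abs_le.1 (abs_inner_sub_le_of_isMinPt hD (h.rotate hsτ) hτ hsτ ha hb')).2
  simp only [inner_add_right, inner_smul_right] at h1
  have h2 := mul_le_mul_of_nonneg_left
    (abs_le.1 (abs_inner_sub_le hD ha.1 hb'.1 h.norm_snd)).1 hs.le
  have h3 := hb'.2 b hb.1
  have h4 := hb.2 b' hb'.1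
  simp only [inner_neg_left, inner_add_left, inner_smul_left, conj_trivial,
    real_inner_comm _ e, real_inner_comm _ f] at h3 h4
  have h5 : ⟪b', e⟫ ≤ ⟪b, e⟫ := by
    refine le_of_mul_le_mul_left ?_ hs
    nlinarith
  by_contra! hcon
  nlinarith

end Width

section BoundaryGradient

variable {Ω : Set E2} {u : E2 → ℝ} {x : E2}

lemma exists_segment_mem_frontier {y z : E2} (hy : y ∈ Ω) (hz : z ∉ Ω) :
    ∃ l ∈ Set.Icc (0 : ℝ) 1, y + l • (z - y) ∈ frontier Ω := by
  have hp : IsPreconnected (segment ℝ y z) := (convex_segment y z).isPreconnected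
  obtain ⟨p, hp1, hp2⟩ : (segment ℝ y z ∩ frontier Ω).Nonempty := by
    by_contra hcon
    rw [Set.not_nonempty_iff_eq_empty, ← Set.disjoint_iff_inter_eq_empty,
      Set.disjoint_left] at hcon
    have hy' : y ∈ interior Ω := by
      by_contra h
      exact hcon (left_mem_segment ℝ y z) ⟨subset_closure hy, h⟩
    have hz' : z ∈ (closure Ω)ᶜ := fun h =>
      hcon (right_mem_segment ℝ y z) ⟨h, fun h' => hz (interior_subset h')⟩
    obtain ⟨p, -, hp1, hp2⟩ := hp _ _ isOpen_interior isClosed_closure.isOpen_compl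
      (fun p hp => by
        by_contra h
        rw [Set.mem_union, not_or, Set.notMem_compl_iff] at h
        exact hcon hp ⟨h.2, h.1⟩)
      ⟨y, left_mem_segment ℝ y z, hy'⟩ ⟨z, right_mem_segment ℝ y z, hz'⟩
    exact hp2 (interior_subset_closure hp1)
  rw [segment_eq_image'] at hp1
  obtain ⟨l, hl, rfl⟩ := hp1
  exact ⟨l, hl, hp2⟩

/-- A function vanishing on the boundary cannot increase both along an interior and along an
exterior direction. -/
lemma false_of_pos_of_pos {L : E2 →L[ℝ] ℝ} {a b : E2} (hu : ∀ y ∈ frontier Ω, u y = 0)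
    (hL : HasFDerivAt u L x) (hx : u x = 0) (ha : ∀ t ∈ Set.Ioc (0 : ℝ) 1, x + t • a ∈ Ω)
    (hb : ∀ t : ℝ, 0 < t → x + t • b ∉ Ω) (hLa : 0 < L a) (hLb : 0 < L b) : False := by
  set m := min (L a) (L b) with hm
  have hm0 : 0 < m := lt_min hLa hLb
  set M := ‖a‖ + ‖b‖ + 1 with hM
  have hM0 : 0 < M := by positivity
  have h1 := (hasFDerivAt_iff_isLittleO_nhds_zero.1 hL).def (c := m / (2 * M)) (by positivity)
  obtain ⟨δ, hδ, h2⟩ := Metric.eventually_nhds_iff.1 h1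
  set t := min 1 (δ / (2 * M)) with ht
  have ht0 : 0 < t := by positivity
  have htδ : t * M < δ := by
    calc t * M ≤ δ / (2 * M) * M := by gcongr; exact min_le_right _ _
      _ = δ / 2 := by field_simp
      _ < δ := by linarith
  obtain ⟨l, hl, h3⟩ := exists_segment_mem_frontier (ha t ⟨ht0, min_le_left _ _⟩) (hb t ht0)
  have h4 : x + t • a + l • (x + t • b - (x + t • a)) = x + t • ((1 - l) • a + l • b) := by
    module
  rw [h4] at h3
  set y := (1 - l) • a + l • b with hy
  have hyM : ‖y‖ ≤ M := by
    calc ‖y‖ ≤ ‖(1 - l) • a‖ + ‖l • b‖ := norm_add_le _ _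
      _ = (1 - l) * ‖a‖ + l * ‖b‖ := by
        rw [norm_smul, norm_smul, Real.norm_of_nonneg hl.1,
          Real.norm_of_nonneg (sub_nonneg.2 hl.2)]
      _ ≤ M := by nlinarith [norm_nonneg a, norm_nonneg b, hl.1, hl.2]
  have hty : ‖t • y‖ ≤ t * M := by
    rw [norm_smul, Real.norm_of_nonneg ht0.le]
    gcongr
  have h5 := h2 (y := t • y) (by rw [dist_zero_right]; exact hty.trans_lt htδ)
  rw [hu _ h3, hx, sub_self, zero_sub, norm_neg, Real.norm_eq_abs, map_smul, smul_eq_mul] at h5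
  have h6 : m ≤ L y := by
    rw [hy, map_add, map_smul, map_smul, smul_eq_mul, smul_eq_mul]
    calc m = (1 - l) * m + l * m := by ring
      _ ≤ _ := add_le_add (mul_le_mul_of_nonneg_left (min_le_left _ _) (sub_nonneg.2 hl.2))
        (mul_le_mul_of_nonneg_left (min_le_right _ _) hl.1)
  have h7 : t * m ≤ m / (2 * M) * (t * M) :=
    (mul_le_mul_of_nonneg_left h6 ht0.le).trans ((le_abs_self _).trans (h5.trans (by gcongr)))
  have h8 : m / (2 * M) * (t * M) = t * m / 2 := by field_simp
  rw [h8] at h7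
  nlinarith [mul_pos ht0 hm0]

lemma exists_mem_interior_inner_ne (hne : (interior Ω).Nonempty) {g : E2} (hg : g ≠ 0) (x : E2) :
    ∃ y ∈ interior Ω, ⟪g, y - x⟫ ≠ 0 := by
  obtain ⟨y, hy⟩ := hne
  by_cases h : ⟪g, y - x⟫ = 0
  · obtain ⟨ε, hε, h1⟩ := Metric.isOpen_iff.1 isOpen_interior y hy
    refine ⟨y + (ε / (2 * ‖g‖)) • g, h1 ?_, ?_⟩
    · have := norm_pos_iff.2 hg
      rw [mem_ball, dist_eq_norm, add_sub_cancel_left, norm_smul, Real.norm_of_nonneg (by positivity)]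
      calc ε / (2 * ‖g‖) * ‖g‖ = ε / 2 := by field_simp
        _ < ε := by linarith
    · rw [add_sub_right_comm, inner_add_right, h, zero_add, inner_smul_right,
        real_inner_self_eq_norm_sq]
      have := norm_pos_iff.2 hg
      positivity
  · exact ⟨y, hy, h⟩

lemma inner_gradient_nonpos {η v : E2} (hc : Convex ℝ Ω) (hΩ : IsClosed Ω)
    (hne : (interior Ω).Nonempty) (hd : DifferentiableAt ℝ u x) (hu : ∀ y ∈ frontier Ω, u y = 0)
    (hx : x ∈ frontier Ω) (hη : IsInwardUnitNormal Ω x η) (hg : ⟪gradient u x, η⟫ = 1)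
    (hv : ⟪v, η⟫ = 0) : ⟪gradient u x, v⟫ ≤ 0 := by
  by_contra! hcon
  have hxΩ : x ∈ Ω := hΩ.frontier_subset hx
  have hg0 : gradient u x ≠ 0 := by
    rintro h0
    rw [h0, inner_zero_left] at hg
    exact zero_ne_one hg
  obtain ⟨y, hy, hne⟩ := exists_mem_interior_inner_ne hne hg0 x
  have ha : ∀ t ∈ Set.Ioc (0 : ℝ) 1, x + t • (y - x) ∈ Ω := fun t ht =>
    hc.add_smul_sub_mem hxΩ (interior_subset hy) ⟨ht.1.le, ht.2⟩
  set g := gradient u x with hgdef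
  have hb : ∀ w : E2, ⟪w, η⟫ < 0 → ∀ t : ℝ, 0 < t → x + t • w ∉ Ω := by
    intro w hw t ht hmem
    have := hη.2 _ hmem
    rw [add_sub_cancel_left, inner_smul_right, real_inner_comm] at this
    nlinarith
  have hηη : ⟪η, η⟫ = 1 := by rw [real_inner_self_eq_norm_sq, hη.1, one_pow]
  have hin : ∀ w, ⟪g, w⟫ = fderiv ℝ u x w := fun w => inner_gradient w x
  rcases hne.lt_or_gt with hlt | hgt
  · refine false_of_pos_of_pos (u := fun z => -u z) (b := -v - (⟪g, v⟫ / 2) • η)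
      (fun z hz => by rw [hu z hz, neg_zero]) hd.hasFDerivAt.neg (by rw [hu x hx, neg_zero]) ha
      (hb _ ?_) ?_ ?_
    · simp only [inner_sub_left, inner_neg_left, inner_smul_left, hv, hηη, conj_trivial]
      linarith
    · rw [neg_apply, ← hin]
      linarith
    · rw [neg_apply, ← hin, inner_sub_right, inner_neg_right, inner_smul_right, hg]
      linarith
  · refine false_of_pos_of_pos (u := u) (b := v - (⟪g, v⟫ / 2) • η) hu hd.hasFDerivAt (hu x hx) ha
      (hb _ ?_) ?_ ?_
    · simp only [inner_sub_left, inner_smul_left, hv, hηη, conj_trivial]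
      linarith
    · rw [← hin]
      linarith
    · rw [← hin, inner_sub_right, inner_smul_right, hg]
      linarith

/-- The frame obtained by rotating a unit vector. -/
lemma isFrame_rot {θ : E2} (hθ : ‖θ‖ = 1) : IsFrame (Rot θ) θ := by
  refine ⟨?_, hθ, ?_⟩
  · rw [← hθ, EuclideanSpace.norm_eq, EuclideanSpace.norm_eq]
    simp [Rot, Fin.sum_univ_two, add_comm]
  · simp [Rot, PiLp.inner_apply, Fin.sum_univ_two]
    ring

/-- A function vanishing on the boundary, with unit normal derivative, has gradient equal to the
normal. -/
lemma gradient_eq_of_frontier {η : E2} (hc : Convex ℝ Ω) (hΩ : IsClosed Ω)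
    (hne : (interior Ω).Nonempty) (hd : DifferentiableAt ℝ u x) (hu : ∀ y ∈ frontier Ω, u y = 0)
    (hx : x ∈ frontier Ω) (hη : IsInwardUnitNormal Ω x η) (hg : ⟪gradient u x, η⟫ = 1) :
    gradient u x = η := by
  have hF := isFrame_rot hη.1
  have h1 := inner_gradient_nonpos hc hΩ hne hd hu hx hη hg hF.inner_eq
  have h2 := inner_gradient_nonpos hc hΩ hne hd hu hx hη hg hF.neg_fst.inner_eq
  rw [inner_neg_right] at h2
  rw [hF.eq_add (gradient u x), hg, le_antisymm h1 (by linarith), zero_smul, zero_add, one_smul]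

end BoundaryGradient

section Exterior

variable {Ω : Set E2} {u : E2 → ℝ} {s τ r : ℝ} {e f z : E2}

lemma gradient_ubarF_of_mem_interior (hz : z ∈ interior Ω) :
    gradient (ubarF r Ω u) z = gradient u z := by
  have h1 : ubarF r Ω u =ᶠ[nhds z] fun y => u y + r := by
    filter_upwards [isOpen_interior.mem_nhds hz] with y hy
    exact if_pos (subset_closure (interior_subset hy))
  rw [h1.gradient_eq, gradient, gradient, fderiv_add_const]

lemma gradient_ubarF_of_notMem (hΩ : IsClosed Ω) (hz : z ∉ Ω) :
    gradient (ubarF r Ω u) z = -gradient (infDist · Ω) z := by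
  have h1 : ubarF r Ω u =ᶠ[nhds z] fun y => r - infDist y Ω := by
    filter_upwards [hΩ.isOpen_compl.mem_nhds hz] with y hy
    exact if_neg (by rwa [hΩ.closure_eq])
  rw [h1.gradient_eq, gradient, gradient, fderiv_const_sub, map_neg]

lemma norm_gradient_infDist_le (z : E2) : ‖gradient (infDist · Ω) z‖ ≤ 1 := by
  rw [gradient, LinearIsometryEquiv.norm_map]
  exact norm_fderiv_le_of_lipschitz ℝ (lipschitz_infDist_pt Ω)

/-- Moving towards the nearest point decreases the distance at unit speed. -/
lemma inner_gradient_infDist_le {p : E2} (hp : p ∈ Ω) (hzp : infDist z Ω = dist z p)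
    (hd : DifferentiableAt ℝ (infDist · Ω) z) :
    ⟪gradient (infDist · Ω) z, p - z⟫ ≤ -dist z p := by
  rw [inner_gradient]
  refine le_of_tendsto (hd.hasFDerivAt.hasLineDerivAt (p - z)).tendsto_slope_zero_right ?_
  filter_upwards [Ioo_mem_nhdsGT (zero_lt_one' ℝ)] with t ht
  have h1 : infDist (z + t • (p - z)) Ω ≤ (1 - t) * dist z p := by
    refine (infDist_le_dist_of_mem hp).trans (le_of_eq ?_)
    have h2 : z + t • (p - z) - p = (1 - t) • (z - p) := by module
    rw [dist_eq_norm, h2, norm_smul, Real.norm_of_nonneg (by linarith [ht.2]), dist_eq_norm]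
  have ht0 : 0 < t := ht.1
  rw [smul_eq_mul, hzp, inv_mul_le_iff₀ ht0]
  linarith

lemma gradient_infDist_eq {p : E2} (hp : p ∈ Ω) (hzp : infDist z Ω = dist z p)
    (hpos : 0 < dist z p) (hd : DifferentiableAt ℝ (infDist · Ω) z) :
    z + dist z p • -gradient (infDist · Ω) z = p := by
  set G := gradient (infDist · Ω) z with hG
  have h1 : ⟪G, p - z⟫ ≤ -dist z p := inner_gradient_infDist_le hp hzp hd
  have h2 : ‖G‖ ≤ 1 := norm_gradient_infDist_le z
  have h3 : ‖dist z p • G + (p - z)‖ ^ 2 ≤ 0 := by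
    rw [norm_add_sq_real, norm_smul, Real.norm_of_nonneg hpos.le, inner_smul_left, conj_trivial,
      ← dist_eq_norm p z, dist_comm p z]
    have h3 := mul_le_mul_of_nonneg_left h1 hpos.le
    have h4 : (dist z p * ‖G‖) ^ 2 ≤ (dist z p * 1) ^ 2 := by gcongr
    linarith
  have h4 : dist z p • G + (p - z) = 0 := by
    rw [← norm_eq_zero]
    exact pow_eq_zero_iff two_ne_zero |>.1 (le_antisymm h3 (sq_nonneg _))
  rw [smul_neg, eq_comm, ← sub_eq_zero, ← h4]
  abel

/-- Outside of `Ω`, the gradient of the extension is the inward normal at the nearest point. -/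
lemma exists_isInwardUnitNormal_gradient (hc : Convex ℝ Ω) (hΩ : IsCompact Ω)
    (hne : Ω.Nonempty) (hz : z ∉ Ω) (hd : DifferentiableAt ℝ (infDist · Ω) z) :
    ∃ p ∈ Ω, IsInwardUnitNormal Ω p (gradient (ubarF r Ω u) z) ∧
      z + dist z p • gradient (ubarF r Ω u) z = p := by
  obtain ⟨p, hp, hzp⟩ := hΩ.exists_infDist_eq_dist hne z
  have hpos : 0 < dist z p := dist_pos.2 fun h => hz (h ▸ hp)
  rw [gradient_ubarF_of_notMem hΩ.isClosed hz]
  have h1 := gradient_infDist_eq hp hzp hpos hd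
  set N := -gradient (infDist · Ω) z
  have h2 : dist z p • N = p - z := eq_sub_of_add_eq' h1
  have h3 : ‖N‖ = 1 := by
    have := congrArg norm h2
    rw [norm_smul, Real.norm_of_nonneg hpos.le, ← dist_eq_norm, dist_comm p z] at this
    exact mul_left_cancel₀ hpos.ne' (this.trans (mul_one _).symm)
  refine ⟨p, hp, ⟨h3, fun y hy => ?_⟩, h1⟩
  have h4 := (norm_eq_iInf_iff_real_inner_le_zero hc (u := z) hp).1 (by
    rw [infDist_eq_iInf] at hzp
    simp only [dist_eq_norm] at hzp
    exact hzp.symm) y hy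
  have h5 : z - p = -(dist z p • N) := by rw [h2]; abel
  rw [h5, inner_neg_left, inner_smul_left, conj_trivial] at h4
  exact nonneg_of_mul_nonneg_right (by linarith) hpos

lemma inner_gradient_ubarF_neg (hD : EikonalData Ω u s) (h : IsFrame e f) (hτ : 0 < τ)
    (hsτ : s ^ 2 + τ ^ 2 = 1) {a b : E2} (ha : IsMinPt Ω (-s • e + τ • f) a)
    (hb : IsMinPt Ω (-s • e + τ • -f) b) (haz : ⟪a, e⟫ < ⟪z, e⟫) (hbz : ⟪b, e⟫ < ⟪z, e⟫)
    (hz : z ∉ Ω) (hd : DifferentiableAt ℝ (infDist · Ω) z) :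
    ⟪gradient (ubarF r Ω u) z, e⟫ < 0 := by
  obtain ⟨p, hp, hN, hzp⟩ := exists_isInwardUnitNormal_gradient (u := u) (r := r) hD.convex
    hD.isCompact (hD.nonempty.mono interior_subset) hz hd
  by_contra! hcon
  have h1 : ⟪z, e⟫ ≤ ⟪p, e⟫ := by
    have h2 := congrArg (fun q => ⟪q, e⟫) hzp
    simp only [inner_add_left, inner_smul_left, conj_trivial] at h2
    have := mul_nonneg (dist_nonneg (x := z) (y := p)) hcon
    linarith
  have hs := hD.pos
  rcases le_total 0 ⟪gradient (ubarF r Ω u) z, f⟫ with hf | hf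
  · have := hN.inner_le_neg h hs hτ hsτ ha hp (haz.trans_le h1) hf
    linarith
  · have := hN.inner_le_neg h.neg_snd hs hτ hsτ hb hp (hbz.trans_le h1)
      (by rw [inner_neg_right]; linarith)
    linarith

end Exterior

section UniqueMinimizer

variable {Ω : Set E2}

/-- The standard parametrisation of the unit circle. -/
def circlePt (t : ℝ) : E2 := !₂[Real.cos t, Real.sin t]

lemma lipschitzWith_circlePt : LipschitzWith 1 circlePt := by
  refine LipschitzWith.of_dist_le_mul fun x y => ?_
  rw [NNReal.coe_one, one_mul, EuclideanSpace.dist_eq]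
  refine Real.sqrt_le_iff.2 ⟨dist_nonneg, ?_⟩
  simp only [circlePt, Fin.sum_univ_two, Real.dist_eq, sq_abs]
  simp
  have h1 := Real.one_sub_sq_div_two_le_cos (x := x - y)
  rw [Real.cos_sub] at h1
  nlinarith [Real.sin_sq_add_cos_sq x, Real.sin_sq_add_cos_sq y]

lemma exists_circlePt_eq {θ : E2} (hθ : θ ∈ sphere (0 : E2) 1) : ∃ t, circlePt t = θ := by
  rw [mem_sphere_zero_iff_norm, EuclideanSpace.norm_eq, Real.sqrt_eq_one, Fin.sum_univ_two,
    Real.norm_eq_abs, Real.norm_eq_abs, sq_abs, sq_abs] at hθ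
  obtain ⟨t, ht⟩ := (Complex.norm_eq_one_iff (⟨θ 0, θ 1⟩ : ℂ)).1 (by
    rw [← sq_eq_sq₀ (norm_nonneg _) zero_le_one, ← Complex.normSq_eq_norm_sq, Complex.normSq_mk]
    linarith)
  refine ⟨t, ?_⟩
  ext i
  fin_cases i
  · have := congrArg Complex.re ht
    rw [Complex.exp_ofReal_mul_I_re] at this
    simpa [circlePt] using this
  · have := congrArg Complex.im ht
    rw [Complex.exp_ofReal_mul_I_im] at this
    simpa [circlePt] using this

lemma hasDerivAt_inner_circlePt (p : E2) (t : ℝ) :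
    HasDerivAt (fun t => ⟪circlePt t, p⟫) (-Real.sin t * p 0 + Real.cos t * p 1) t := by
  have h1 : (fun t => ⟪circlePt t, p⟫) = fun t => Real.cos t * p 0 + Real.sin t * p 1 := by
    ext t
    simp [circlePt, PiLp.inner_apply, Fin.sum_univ_two, mul_comm]
  rw [h1]
  exact ((Real.hasDerivAt_cos t).mul_const _).add ((Real.hasDerivAt_sin t).mul_const _)

lemma eq_of_isMinPt_circlePt {H : ℝ → ℝ} {t : ℝ} (hd : DifferentiableAt ℝ H t)
    (hH : ∀ x p, p ∈ Ω → H x ≤ ⟪circlePt x, p⟫) {p p' : E2} (hp : p ∈ Ω) (hp' : p' ∈ Ω)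
    (h : H t = ⟪circlePt t, p⟫) (h' : H t = ⟪circlePt t, p'⟫) : p = p' := by
  have key : ∀ q ∈ Ω, H t = ⟪circlePt t, q⟫ →
      -Real.sin t * q 0 + Real.cos t * q 1 = deriv H t := by
    intro q hq hqt
    have h1 := (hasDerivAt_inner_circlePt q t).sub hd.hasDerivAt
    refine sub_eq_zero.1 (IsLocalMin.hasDerivAt_eq_zero (Filter.Eventually.of_forall fun x => ?_) h1)
    simp only [Pi.sub_apply]
    rw [hqt, sub_self]
    exact sub_nonneg.2 (hH x q hq)
  have h1 := (key p hp h).trans (key p' hp' h').symm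
  have h2 : Real.cos t * p 0 + Real.sin t * p 1 = Real.cos t * p' 0 + Real.sin t * p' 1 := by
    have := h.symm.trans h'
    simpa [circlePt, PiLp.inner_apply, Fin.sum_univ_two, mul_comm] using this
  have h3 := Real.sin_sq_add_cos_sq t
  ext i
  fin_cases i
  · change p 0 = p' 0
    linear_combination Real.cos t * h2 - Real.sin t * h1 - (p 0 - p' 0) * h3
  · change p 1 = p' 1
    linear_combination Real.sin t * h2 + Real.cos t * h1 - (p 1 - p' 1) * h3

/-- The directions in which a linear functional has several minimisers on `Ω`. -/
def flatDirections (Ω : Set E2) : Set E2 :=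
  {θ ∈ sphere (0 : E2) 1 | ∃ p p', IsMinPt Ω θ p ∧ IsMinPt Ω θ p' ∧ p ≠ p'}

lemma hausdorffMeasure_flatDirections (hΩ : IsCompact Ω) (hne : (interior Ω).Nonempty) :
    μH[1] (flatDirections Ω) = 0 := by
  choose m hm using fun t => exists_isMinPt hΩ hne (circlePt t)
  set H : ℝ → ℝ := fun t => ⟪circlePt t, m t⟫ with hH
  obtain ⟨M, hM0, hM⟩ := hΩ.isBounded.exists_pos_norm_le
  have hHM : LipschitzWith ⟨M, hM0.le⟩ H := by
    refine LipschitzWith.of_le_add_mul _ fun x y => ?_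
    have h1 : H x ≤ ⟪circlePt x, m y⟫ := (hm x).2 _ (hm y).1
    have h2 : ⟪circlePt x - circlePt y, m y⟫ ≤ dist x y * M := by
      refine (real_inner_le_norm _ _).trans ?_
      have h3 := lipschitzWith_circlePt.dist_le_mul x y
      rw [NNReal.coe_one, one_mul, dist_eq_norm] at h3
      exact mul_le_mul h3 (hM _ (hm y).1) (norm_nonneg _) dist_nonneg
    rw [inner_sub_left] at h2
    change H x ≤ H y + M * dist x y
    simp only [hH] at h1 ⊢
    linarith
  have h1 : flatDirections Ω ⊆ circlePt '' {t | ¬ DifferentiableAt ℝ H t} := by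
    rintro θ ⟨hθ, p, p', hp, hp', hpp⟩
    obtain ⟨t, rfl⟩ := exists_circlePt_eq hθ
    refine ⟨t, fun hd => hpp ?_, rfl⟩
    exact eq_of_isMinPt_circlePt hd (fun x q hq => (hm x).2 q hq) hp.1 hp'.1
      (le_antisymm ((hm t).2 _ hp.1) (hp.2 _ (hm t).1))
      (le_antisymm ((hm t).2 _ hp'.1) (hp'.2 _ (hm t).1))
  have h2 : volume {t | ¬ DifferentiableAt ℝ H t} = 0 := hHM.ae_differentiableAt_real
  have h3 := lipschitzWith_circlePt.hausdorffMeasure_image_le zero_le_one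
    {t | ¬ DifferentiableAt ℝ H t}
  rw [hausdorffMeasure_real, h2, mul_zero] at h3
  exact measure_mono_null h1 (le_antisymm h3 zero_le)

/-- For almost every direction, the linear functional has a unique minimiser and a unique
maximiser. -/
lemma ae_notMem_flatDirections (hΩ : IsCompact Ω) (hne : (interior Ω).Nonempty) :
    ∀ᵐ θ ∂(μH[1] : Measure E2), θ ∉ flatDirections Ω ∧ -θ ∉ flatDirections Ω := by
  have h1 := hausdorffMeasure_flatDirections hΩ hne
  refine Filter.Eventually.and (measure_eq_zero_iff_ae_notMem.1 h1) ?_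
  have h2 : μH[1] (Neg.neg ⁻¹' flatDirections Ω) = 0 := by
    rw [← h1]
    exact (IsometryEquiv.neg E2).hausdorffMeasure_preimage 1 _
  exact measure_eq_zero_iff_ae_notMem.1 h2

end UniqueMinimizer

section Thickening

variable {Ω : Set E2} {r : ℝ} {θ a : E2}

lemma inner_pos_of_mem_thickening (hθ : ‖θ‖ = 1) (ha : IsMinPt Ω θ a) {z : E2}
    (hz : z ∈ thickening r Ω) : 0 < ⟪θ, z - (a - r • θ)⟫ := by
  obtain ⟨w, hw, hzw⟩ := mem_thickening_iff.1 hz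
  have h1 := ha.2 w hw
  have h2 : ⟪θ, w - z⟫ < r := by
    refine (real_inner_le_norm _ _).trans_lt ?_
    rwa [hθ, one_mul, ← dist_eq_norm, dist_comm]
  simp only [inner_sub_right, inner_smul_right, real_inner_self_eq_norm_sq, hθ] at h2 ⊢
  linarith

lemma isInwardUnitNormal_thickening (hθ : ‖θ‖ = 1) (ha : IsMinPt Ω θ a) :
    IsInwardUnitNormal (thickening r Ω) (a - r • θ) θ :=
  ⟨hθ, fun _ hz => (inner_pos_of_mem_thickening hθ ha hz).le⟩

lemma sub_smul_mem_closure_thickening (hr : 0 < r) (hθ : ‖θ‖ = 1) (ha : a ∈ Ω) :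
    a - r • θ ∈ closure (thickening r Ω) := by
  rw [closure_thickening hr]
  refine mem_cthickening_of_dist_le _ a r Ω ha ?_
  rw [dist_eq_norm, sub_sub_cancel_left, norm_neg, norm_smul, hθ, mul_one,
    Real.norm_of_nonneg hr.le]

lemma sub_smul_mem_frontier_thickening (hr : 0 < r) (hθ : ‖θ‖ = 1) (ha : IsMinPt Ω θ a) :
    a - r • θ ∈ frontier (thickening r Ω) := by
  rw [isOpen_thickening.frontier_eq]
  refine ⟨sub_smul_mem_closure_thickening hr hθ ha.1, fun h => ?_⟩
  have := inner_pos_of_mem_thickening hθ ha h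
  rw [sub_self, inner_zero_right] at this
  exact this.false

/-- A boundary point of the neighbourhood with normal `θ` projects to a minimiser. -/
lemma isMinPt_of_isInwardUnitNormal_thickening (hΩ : IsCompact Ω) (hr : 0 < r)
    (ha : a ∈ frontier (thickening r Ω)) (hN : IsInwardUnitNormal (thickening r Ω) a θ) :
    IsMinPt Ω θ (a + r • θ) := by
  have h1 : closure (thickening r Ω) ⊆ {z | 0 ≤ ⟪θ, z - a⟫} :=
    closure_minimal hN.2 (isClosed_le continuous_const (by fun_prop))
  have h2 : ∀ w ∈ Ω, ⟪θ, a⟫ + r ≤ ⟪θ, w⟫ := by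
    intro w hw
    have h3 : 0 ≤ ⟪θ, w - r • θ - a⟫ := h1 (sub_smul_mem_closure_thickening hr hN.1 hw)
    simp only [inner_sub_right, inner_smul_right, real_inner_self_eq_norm_sq, hN.1] at h3
    linarith
  have h3 := frontier_subset_closure ha
  rw [closure_thickening hr, hΩ.cthickening_eq_biUnion_closedBall hr.le] at h3
  simp only [Set.mem_iUnion, mem_closedBall, exists_prop] at h3
  obtain ⟨p, hp, hap⟩ := h3
  have h4 : ‖p - a - r • θ‖ ^ 2 ≤ 0 := by
    rw [norm_sub_sq_real, norm_smul, hN.1, inner_smul_right, real_inner_comm, inner_sub_right,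
      mul_one, Real.norm_of_nonneg hr.le, ← dist_eq_norm, dist_comm]
    have h5 := mul_le_mul_of_nonneg_left (h2 p hp) hr.le
    have h6 : dist a p ^ 2 ≤ r ^ 2 := by gcongr
    linarith
  have h5 : p = a + r • θ := by
    have := norm_eq_zero.1 (pow_eq_zero_iff two_ne_zero |>.1 (le_antisymm h4 (sq_nonneg _)))
    rw [sub_eq_zero] at this
    rw [← this]
    abel
  refine ⟨h5 ▸ hp, fun w hw => ?_⟩
  rw [inner_add_right, inner_smul_right, real_inner_self_eq_norm_sq, hN.1, one_pow, mul_one]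
  exact h2 w hw

end Thickening

lemma rot_eq {θ : E2} (hθ : ‖θ‖ = 1) (w : E2) :
    Rot w = ⟪w, θ⟫ • Rot θ - ⟪w, Rot θ⟫ • θ := by
  have h1 : θ 0 ^ 2 + θ 1 ^ 2 = 1 := by
    rwa [EuclideanSpace.norm_eq, Real.sqrt_eq_one, Fin.sum_univ_two, Real.norm_eq_abs,
      Real.norm_eq_abs, sq_abs, sq_abs] at hθ
  ext i
  fin_cases i
  · simp [Rot, PiLp.inner_apply, Fin.sum_univ_two]
    linear_combination w 1 * h1
  · simp [Rot, PiLp.inner_apply, Fin.sum_univ_two]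
    linear_combination -w 0 * h1

lemma rotInv_eq_neg (w : E2) : RotInv w = -Rot w := by
  ext i
  fin_cases i <;> simp [Rot, RotInv]

/-- Both rotations by a right angle turn a unit vector into an adapted frame. -/
lemma isFrame_of_rotation {R₀ R₀inv : E2 → E2}
    (hR : (R₀ = Rot ∧ R₀inv = RotInv) ∨ (R₀ = RotInv ∧ R₀inv = Rot)) {θ : E2} (hθ : ‖θ‖ = 1) :
    IsFrame (R₀ θ) θ ∧ R₀inv θ = -R₀ θ ∧
      ∀ w, R₀ w = ⟪w, θ⟫ • R₀ θ - ⟪w, R₀ θ⟫ • θ := by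
  rcases hR with ⟨rfl, rfl⟩ | ⟨rfl, rfl⟩
  · exact ⟨isFrame_rot hθ, rotInv_eq_neg θ, rot_eq hθ⟩
  · refine ⟨?_, ?_, fun w => ?_⟩
    · rw [rotInv_eq_neg]
      exact (isFrame_rot hθ).neg_fst
    · rw [rotInv_eq_neg, neg_neg]
    · rw [rotInv_eq_neg, rotInv_eq_neg, rot_eq hθ w, inner_neg_right]
      module

section Assembly

variable {Ω : Set E2} {u : E2 → ℝ} {s : ℝ} {e f a b : E2}

lemma abs_inner_sub_le_of_mem_thickening (hD : EikonalData Ω u s) {z w v : E2}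
    (hz : z ∈ thickening (1 / 10) Ω) (hw : w ∈ Ω) (hv : ‖v‖ = 1) :
    |⟪z, v⟫ - ⟪w, v⟫| ≤ 3 := by
  obtain ⟨y, hy, hzy⟩ := mem_thickening_iff.1 hz
  have h1 := abs_inner_sub_le hD hy hw hv
  have h2 : |⟪z, v⟫ - ⟪y, v⟫| ≤ 1 / 10 := by
    rw [← inner_sub_left]
    refine (abs_real_inner_le_norm _ _).trans ?_
    rw [hv, mul_one, ← dist_eq_norm]
    exact hzy.le
  have h3 := abs_sub_le ⟪z, v⟫ ⟪y, v⟫ ⟪w, v⟫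
  linarith

/-- The gradient points away from the far side of the line through the midpoint of the chord. -/
lemma volume_le_of_isMinPt (hD : EikonalData Ω u s) (h : IsFrame e f) (hs : s ≤ 1 / 2)
    (ha : IsMinPt Ω f a) (hb : IsMinPt Ω (-f) b) :
    volume {z | z ∈ thickening (1 / 10) Ω ∧
      (⟪a, e⟫ + ⟪b, e⟫) / 2 - 1500 * s ≤ ⟪z, e⟫ ∧ 0 ≤ ⟪gradient (ubarF (1 / 10) Ω u) z, e⟫} ≤
      ENNReal.ofReal (10578 * s) := by
  have hs0 := hD.pos
  set τ := Real.sqrt (1 - s ^ 2) with hτdef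
  have hs2 : 0 ≤ 1 - s ^ 2 := by nlinarith
  have hsτ : s ^ 2 + τ ^ 2 = 1 := by rw [hτdef, Real.sq_sqrt hs2]; ring
  have hτ : 1 / 2 ≤ τ := Real.le_sqrt_of_sq_le (by nlinarith)
  have hτ0 : 0 < τ := by linarith
  obtain ⟨p, hp⟩ := exists_isMinPt hD.isCompact hD.nonempty (-s • e + τ • f)
  obtain ⟨q, hq⟩ := exists_isMinPt hD.isCompact hD.nonempty (-s • e + τ • -f)
  have hpb := inner_le_of_isMinPt hD h hτ hsτ hp hb
  have hqa := inner_le_of_isMinPt hD h.neg_snd hτ hsτ hq (by rwa [neg_neg])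
  have hab := abs_le.1 (abs_inner_sub_le_of_isMinPt hD h hτ hsτ ha hb)
  set c := max ⟪a, e⟫ ⟪b, e⟫ + 205 * s with hc
  have hpc : ⟪p, e⟫ < c := by linarith [le_max_right ⟪a, e⟫ ⟪b, e⟫]
  have hqc : ⟪q, e⟫ < c := by linarith [le_max_left ⟪a, e⟫ ⟪b, e⟫]
  have hcle : c ≤ (⟪a, e⟫ + ⟪b, e⟫) / 2 + 255 * s := by
    rw [hc]
    rcases max_choice ⟪a, e⟫ ⟪b, e⟫ with h1 | h1 <;> rw [h1] <;> linarith [hab.1, hab.2]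
  set lo := (⟪a, e⟫ + ⟪b, e⟫) / 2 - 1500 * s with hlo
  set S₁ := {z | z ∈ Ω ∧ c ≤ ⟪z, e⟫ ∧ 0 ≤ ⟪gradient u z, e⟫} with hS₁
  set S₂ := {z | z ∈ thickening (1 / 10) Ω ∧ lo ≤ ⟪z, e⟫ ∧ ⟪z, e⟫ ≤ c} with hS₂
  have hsub : {z | z ∈ thickening (1 / 10) Ω ∧ lo ≤ ⟪z, e⟫ ∧
      0 ≤ ⟪gradient (ubarF (1 / 10) Ω u) z, e⟫} ⊆
      (S₁ ∪ S₂) ∪ (frontier Ω ∪ {z | ¬ DifferentiableAt ℝ (infDist · Ω) z}) := by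
    rintro z ⟨hzU, hzlo, hz⟩
    rcases le_or_gt ⟪z, e⟫ c with hzc | hzc
    · exact Or.inl (Or.inr ⟨hzU, hzlo, hzc⟩)
    · by_cases hzΩ : z ∈ Ω
      · by_cases hzi : z ∈ interior Ω
        · rw [gradient_ubarF_of_mem_interior hzi] at hz
          exact Or.inl (Or.inl ⟨hzΩ, hzc.le, hz⟩)
        · exact Or.inr (Or.inl ⟨subset_closure hzΩ, hzi⟩)
      · refine Or.inr (Or.inr fun hd => ?_)
        have := inner_gradient_ubarF_neg (r := 1 / 10) hD h hτ0 hsτ hp hq (hpc.trans hzc)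
          (hqc.trans hzc) hzΩ hd
        linarith
  have h1 : volume S₁ ≤ ENNReal.ofReal (48 * s) := volume_le_of_lt hD h hτ0 hsτ hp hq hpc hqc
  have h2 : volume S₂ ≤ ENNReal.ofReal (1755 * s * 6) := by
    have h3 := h.volume_le (S := S₂) (x₀ := lo) (x₁ := c) (y₀ := ⟪a, f⟫ - 3) (y₁ := ⟪a, f⟫ + 3)
      (fun z hz => ⟨hz.2, by
        have := abs_le.1 (abs_inner_sub_le_of_mem_thickening hD hz.1 ha.1 h.norm_snd)
        constructor <;> linarith [this.1, this.2]⟩)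
    rw [ENNReal.ofReal_mul (by positivity)]
    refine h3.trans (mul_le_mul' ?_ ?_) <;> refine ENNReal.ofReal_le_ofReal ?_ <;> linarith
  have h3 : volume (frontier Ω ∪ {z | ¬ DifferentiableAt ℝ (infDist · Ω) z}) = 0 :=
    measure_union_null (hD.convex.addHaar_frontier volume)
      (lipschitz_infDist_pt Ω).ae_differentiableAt
  calc _ ≤ volume S₁ + volume S₂ + 0 := by
        rw [← h3]
        exact (measure_mono hsub).trans
          ((measure_union_le _ _).trans (add_le_add_left (measure_union_le _ _) _))
    _ ≤ ENNReal.ofReal (48 * s) + ENNReal.ofReal (1755 * s * 6) := by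
        rw [add_zero]
        exact add_le_add h1 h2
    _ = ENNReal.ofReal (10578 * s) := by
        rw [← ENNReal.ofReal_add (by positivity) (by positivity)]
        congr 1
        ring

lemma volume_halfPlane_diff_le (hD : EikonalData Ω u s) {R₀ R₀inv : E2 → E2}
    (hR : (R₀ = Rot ∧ R₀inv = RotInv) ∨ (R₀ = RotInv ∧ R₀inv = Rot)) {θ : E2} (hθ : ‖θ‖ = 1)
    (hs : s ≤ 1 / 2) (ha : IsMinPt Ω θ a) (hb : IsMinPt Ω (-θ) b) {a' b' : E2}
    (ha' : a' = a - (1 / 10 : ℝ) • θ) (hb' : b' = b - (1 / 10 : ℝ) • -θ) :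
    volume ((thickening (1 / 10) Ω ∩
        halfPlane ((2 : ℝ)⁻¹ • (a' + b')) (R₀ (‖b' - a'‖⁻¹ • (b' - a')))) \
      {z ∈ thickening (1 / 10) Ω | 0 < ⟪gradient (ubarF (1 / 10) Ω u) z, R₀inv θ⟫}) ≤
      ENNReal.ofReal (10578 * s) := by
  have hs0 := hD.pos
  obtain ⟨h, hinv, hrot⟩ := isFrame_of_rotation hR hθ
  set e := R₀ θ
  refine (measure_mono ?_).trans (volume_le_of_isMinPt hD h hs ha hb)
  rintro z ⟨⟨hzU, hzH⟩, hzG⟩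
  refine ⟨hzU, ?_, ?_⟩
  swap
  · by_contra! hcon
    refine hzG ⟨hzU, ?_⟩
    rw [hinv, inner_neg_right]
    linarith
  have hs2 : 0 ≤ 1 - s ^ 2 := by nlinarith
  have hκ := abs_le.1 (abs_inner_sub_le_of_isMinPt (τ := Real.sqrt (1 - s ^ 2)) hD h
    (Real.le_sqrt_of_sq_le (by nlinarith)) (by rw [Real.sq_sqrt hs2]; ring) ha hb)
  have hWab := ha.2 b hb.1
  rw [real_inner_comm, real_inner_comm b] at hWab
  have hza := abs_le.1 (abs_inner_sub_le_of_mem_thickening hD hzU ha.1 hθ)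
  have hzb := abs_le.1 (abs_inner_sub_le_of_mem_thickening hD hzU hb.1 hθ)
  have hzH' : 0 < ⟪z - (2 : ℝ)⁻¹ • (a' + b'), R₀ (‖b' - a'‖⁻¹ • (b' - a'))⟫ := hzH
  have hmid : a' + b' = a + b := by rw [ha', hb']; module
  have hdiff : b' - a' = (b - a) + (1 / 5 : ℝ) • θ := by rw [ha', hb']; module
  have hpos : 0 ≤ ‖b' - a'‖⁻¹ := by positivity
  rw [hmid, hrot] at hzH'
  set m := ‖b' - a'‖⁻¹
  rw [hdiff] at hzH'
  simp only [inner_sub_left, inner_sub_right, inner_smul_left, inner_smul_right, inner_add_left,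
    conj_trivial, h.inner_eq', h.inner_snd_self] at hzH'
  set xe := ⟪z, e⟫ - 2⁻¹ * (⟪a, e⟫ + ⟪b, e⟫) with hxe
  set xf := ⟪z, θ⟫ - 2⁻¹ * (⟪a, θ⟫ + ⟪b, θ⟫) with hxf
  have h1 : 0 < m * ((⟪b, θ⟫ - ⟪a, θ⟫ + 1 / 5) * xe - (⟪b, e⟫ - ⟪a, e⟫) * xf) := by
    calc _ < _ := hzH'
      _ = _ := by rw [hxe, hxf]; ring
  have h2 := (pos_iff_pos_of_mul_pos h1).1 (hpos.lt_of_ne (left_ne_zero_of_mul h1.ne').symm)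
  have h3 : |(⟪b, e⟫ - ⟪a, e⟫) * xf| ≤ 100 * s * 3 := by
    rw [abs_mul]
    refine mul_le_mul ?_ ?_ (abs_nonneg _) (by positivity) <;> rw [abs_le] <;> constructor <;>
      linarith [hκ.1, hκ.2, hza.1, hza.2, hzb.1, hzb.2]
  have h4 : -(1500 * s) ≤ xe := by
    by_contra! hcon
    have h5 := (abs_le.1 h3).1
    have h6 : (⟪b, θ⟫ - ⟪a, θ⟫ + 1 / 5) * xe ≤ 1 / 5 * xe :=
      mul_le_mul_of_nonpos_right (by linarith) (by linarith)
    linarith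
  linarith

lemma volume_thickening_le (hD : EikonalData Ω u s) (h : IsFrame e f) :
    volume (thickening (1 / 10) Ω) ≤ ENNReal.ofReal 36 := by
  obtain ⟨w, hw⟩ := hD.nonempty
  have hw' := interior_subset hw
  have h1 := h.volume_le (S := thickening (1 / 10) Ω) (x₀ := ⟪w, e⟫ - 3) (x₁ := ⟪w, e⟫ + 3)
    (y₀ := ⟪w, f⟫ - 3) (y₁ := ⟪w, f⟫ + 3) (fun z hz => by
      have h1 := abs_le.1 (abs_inner_sub_le_of_mem_thickening hD hz hw' h.norm_fst)
      have h2 := abs_le.1 (abs_inner_sub_le_of_mem_thickening hD hz hw' h.norm_snd)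
      refine ⟨⟨?_, ?_⟩, ?_, ?_⟩ <;> linarith [h1.1, h1.2, h2.1, h2.2])
  refine h1.trans (le_of_eq ?_)
  rw [← ENNReal.ofReal_mul (by linarith)]
  congr 1
  ring

end Assembly

/-- Lemma 3 of the paper: for a.e. direction `θ ∈ Γ` the half of `U` cut off by
the chord `[a_θ, b_θ]` (rotated by `R₀`) is, up to measure `cβ^{1/24}`, contained in the set
where `∇ū · R₀⁻¹θ > 0`. -/
theorem statement6 :
    ∀ c₀ : ℝ, 0 < c₀ → ∃ c : ℝ, 0 < c ∧
      ∀ (β : ℝ) (Ω : Set E2) (u : E2 → ℝ) (η : E2 → E2) (Γ : Set E2),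
        0 < β →
        Convex ℝ Ω → IsCompact Ω → (interior Ω).Nonempty → Metric.diam Ω = 2 →
        ContDiff ℝ 2 u →
        (∫ z in Ω, |1 - ‖gradient u z‖ ^ 2| * ‖fderiv ℝ (gradient u) z‖) ≤ β →
        (∫ z in Ω, |1 - ‖gradient u z‖ ^ 2| ^ 2) ≤ β ^ 2 →
        (∀ x ∈ frontier Ω, u x = 0) →
        (∀ x ∈ frontier Ω, IsInwardUnitNormal Ω x (η x)) →
        (∀ x ∈ frontier Ω, ⟪gradient u x, η x⟫ = 1) →
        -- `Γ` is the set provided by the compactness lemma (Lemma 1), applied to `ū` on `U`: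
        Γ ⊆ sphere (0 : E2) 1 →
        μH[1] (sphere (0 : E2) 1 \ Γ) ≤ ENNReal.ofReal (c₀ * β ^ ((1 : ℝ) / 8)) →
        (∀ θ : E2, θ ∈ Γ ↔ -θ ∈ Γ) →
        (∀ θ ∈ Γ, ∃ w : E2 → ℝ, Differentiable ℝ w ∧
          (∫ z in Metric.thickening (1 / 10) Ω,
              ‖gradient w z - Rot (lamVec θ (Rot (gradient (ubarF (1 / 10) Ω u) z)))‖) ≤
            c₀ * β ^ ((1 : ℝ) / 8)) →
        ∀ R₀ R₀inv : E2 → E2,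
          ((R₀ = Rot ∧ R₀inv = RotInv) ∨ (R₀ = RotInv ∧ R₀inv = Rot)) →
          ∀ᵐ θ ∂((μH[1] : Measure E2).restrict Γ),
            ∃ a b : E2,
              a ∈ frontier (Metric.thickening (1 / 10) Ω) ∧
              IsInwardUnitNormal (Metric.thickening (1 / 10) Ω) a θ ∧
              b ∈ frontier (Metric.thickening (1 / 10) Ω) ∧
              IsInwardUnitNormal (Metric.thickening (1 / 10) Ω) b (-θ) ∧
              (∀ a' : E2, a' ∈ frontier (Metric.thickening (1 / 10) Ω) →
                IsInwardUnitNormal (Metric.thickening (1 / 10) Ω) a' θ → a' = a) ∧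
              (∀ b' : E2, b' ∈ frontier (Metric.thickening (1 / 10) Ω) →
                IsInwardUnitNormal (Metric.thickening (1 / 10) Ω) b' (-θ) → b' = b) ∧
              (volume ((Metric.thickening (1 / 10) Ω ∩
                  halfPlane ((2 : ℝ)⁻¹ • (a + b)) (R₀ (‖b - a‖⁻¹ • (b - a)))) \
                {z ∈ Metric.thickening (1 / 10) Ω |
                  0 < ⟪gradient (ubarF (1 / 10) Ω u) z, R₀inv θ⟫})).toReal ≤
                c * β ^ ((1 : ℝ) / 24) := by
  intro c₀ _
  refine ⟨20000, by norm_num, ?_⟩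
  intro β Ω u η Γ hβ hc hΩ hne hdiam hu henergy _ hu0 hη hgη hΓ _ _ _ R₀ R₀inv hR
  have hΓae : ∀ᵐ θ ∂((μH[1] : Measure E2).restrict Γ), θ ∈ sphere (0 : E2) 1 :=
    ae_restrict_of_ae_restrict_of_subset hΓ (ae_restrict_mem isClosed_sphere.measurableSet)
  filter_upwards [hΓae, ae_restrict_of_ae (ae_notMem_flatDirections hΩ hne)] with θ hθ hflat
  have hθ1 : ‖θ‖ = 1 := mem_sphere_zero_iff_norm.1 hθ
  have hθ1' : ‖-θ‖ = 1 := by rw [norm_neg, hθ1]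
  obtain ⟨a, ha⟩ := exists_isMinPt hΩ hne θ
  obtain ⟨b, hb⟩ := exists_isMinPt hΩ hne (-θ)
  have hr : (0 : ℝ) < 1 / 10 := by norm_num
  refine ⟨a - (1 / 10 : ℝ) • θ, b - (1 / 10 : ℝ) • -θ,
    sub_smul_mem_frontier_thickening hr hθ1 ha, isInwardUnitNormal_thickening hθ1 ha,
    sub_smul_mem_frontier_thickening hr hθ1' hb, isInwardUnitNormal_thickening hθ1' hb,
    fun a' ha' hN => ?_, fun b' hb' hN => ?_, ?_⟩
  · by_contra hne'
    exact hflat.1 ⟨hθ, _, a, isMinPt_of_isInwardUnitNormal_thickening hΩ hr ha' hN, ha,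
      fun h => hne' (eq_sub_of_add_eq h)⟩
  · by_contra hne'
    exact hflat.2 ⟨by rwa [mem_sphere_zero_iff_norm], _, b,
      isMinPt_of_isInwardUnitNormal_thickening hΩ hr hb' hN, hb,
      fun h => hne' (eq_sub_of_add_eq h)⟩
  set s := β ^ ((1 : ℝ) / 4) with hs
  have hs0 : 0 < s := by positivity
  have hs4 : s ^ 4 = β := by
    rw [hs, ← Real.rpow_natCast, ← Real.rpow_mul hβ.le]
    norm_num
  have hD : EikonalData Ω u s :=
    { contDiff := hu
      convex := hc
      isCompact := hΩ
      nonempty := hne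
      diam_eq := hdiam
      pos := hs0
      energy := henergy.trans_eq hs4.symm
      normal := fun x hx => by
        rw [gradient_eq_of_frontier hc hΩ.isClosed hne
          (hu.differentiable two_ne_zero x) hu0 hx (hη x hx) (hgη x hx)]
        exact hη x hx }
  have hβr : 0 < β ^ ((1 : ℝ) / 24) := by positivity
  refine ENNReal.toReal_le_of_le_ofReal (by positivity) ?_
  rcases le_total s (1 / 2) with hs2 | hs2
  · refine (volume_halfPlane_diff_le hD hR hθ1 hs2 ha hb rfl rfl).trans
      (ENNReal.ofReal_le_ofReal ?_)
    have hβ1 : β ≤ 1 := by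
      rw [← hs4]
      exact pow_le_one₀ hs0.le (by linarith)
    have : s ≤ β ^ ((1 : ℝ) / 24) :=
      Real.rpow_le_rpow_of_exponent_ge hβ hβ1 (by norm_num)
    linarith
  · refine (measure_mono fun z hz => hz.1.1).trans
      ((volume_thickening_le hD (isFrame_rot hθ1)).trans (ENNReal.ofReal_le_ofReal ?_))
    have hβ16 : 1 / 16 ≤ β := by
      rw [← hs4]
      calc (1 : ℝ) / 16 = (1 / 2) ^ 4 := by norm_num
        _ ≤ s ^ 4 := by gcongr
    have h1 : (1 : ℝ) / 16 ≤ β ^ ((1 : ℝ) / 24) := by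
      calc (1 : ℝ) / 16 = (1 / 16) ^ (1 : ℝ) := (Real.rpow_one _).symm
        _ ≤ (1 / 16) ^ ((1 : ℝ) / 24) :=
          Real.rpow_le_rpow_of_exponent_ge (by norm_num) (by norm_num) (by norm_num)
        _ ≤ β ^ ((1 : ℝ) / 24) := by gcongr
    linarith
end
end

section
/- Let β > 0 be sufficiently small and let Ω ⊂ ℝ² be a convex body with |Ω △ B₁(0)| ≤ β. For θ ∈ S¹ let a_θ denote the point ∂Ω ∩ {tθ : t > 0}. Then there exists a universal constant c > 0 such that: (i) ||a_θ| − 1| ≤ c√β for every θ ∈ S¹, hence ∂Ω ⊂ N_{c√β}(∂B₁(0)); and (ii) |η_{a_θ} + θ| ≤ c·β^{1/4} for every θ ∈ S¹, where η_{a_θ} is the inward pointing unit normal to ∂Ω at a_θ (whenever it exists). -/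
open MeasureTheory Metric
open scoped RealInnerProductSpace ENNReal

noncomputable section

/-- A disc of radius `ρ` contained in a planar set of area at most `β` has `ρ ≤ √β`. -/
theorem radius_le_sqrt_of_ball_subset {S : Set E2} {x : E2} {ρ β : ℝ} (hS : volume S ≠ ⊤)
    (hβ : (volume S).toReal ≤ β) (hsub : ball x ρ ⊆ S) : ρ ≤ Real.sqrt β := by
  rcases le_or_gt ρ 0 with hρ | hρ
  · exact hρ.trans (Real.sqrt_nonneg β)
  apply Real.le_sqrt_of_sq_le
  have h1 : (volume (ball x ρ)).toReal ≤ (volume S).toReal :=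
    ENNReal.toReal_mono hS (measure_mono hsub)
  rw [EuclideanSpace.volume_ball_fin_two, ENNReal.toReal_mul, ENNReal.toReal_pow,
    ENNReal.toReal_ofReal hρ.le] at h1
  rw [ENNReal.toReal_ofReal Real.pi_pos.le] at h1
  nlinarith [Real.pi_gt_three, sq_nonneg ρ]

/-- A point outside the interior of a convex body has a weakly supporting direction. -/
theorem exists_unit_inner_le_norm {Ω : Set E2} (hconv : Convex ℝ Ω)
    (hint : (interior Ω).Nonempty) {x : E2} (hx : x ∉ interior Ω) :
    ∃ u : E2, ‖u‖ = 1 ∧ ∀ z ∈ Ω, ⟪u, z⟫ ≤ ‖x‖ := by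
  obtain ⟨f, hf⟩ := geometric_hahn_banach_open_point hconv.interior isOpen_interior hx
  obtain ⟨v, rfl⟩ := (InnerProductSpace.toDual ℝ E2).surjective f
  simp only [InnerProductSpace.toDual_apply_apply] at hf
  have hv : v ≠ 0 := by
    rintro rfl
    obtain ⟨y, hy⟩ := hint
    simpa using hf y hy
  have hvn : 0 < ‖v‖ := norm_pos_iff.mpr hv
  have hle : ∀ z ∈ Ω, ⟪v, z⟫ ≤ ⟪v, x⟫ := by
    intro z hz
    have hzc : z ∈ closure (interior Ω) := by
      rw [hconv.closure_interior_eq_closure_of_nonempty_interior hint]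
      exact subset_closure hz
    have hcl : IsClosed {w : E2 | ⟪v, w⟫ ≤ ⟪v, x⟫} :=
      isClosed_le (by fun_prop) continuous_const
    exact closure_minimal (fun w hw => (hf w hw).le) hcl hzc
  refine ⟨‖v‖⁻¹ • v, by rw [norm_smul, norm_inv, norm_norm, inv_mul_cancel₀ hvn.ne'], ?_⟩
  intro z hz
  rw [real_inner_smul_left, inv_mul_le_iff₀ hvn]
  exact (hle z hz).trans (real_inner_le_norm v x)

/-- A point outside the interior of `Ω` is at distance at most `2√β` from the complement of the
unit disc. -/
theorem one_sub_norm_le_of_notMem_interior {Ω : Set E2} {β : ℝ} (hconv : Convex ℝ Ω)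
    (hint : (interior Ω).Nonempty) (hfin : volume (symmDiff Ω (ball (0 : E2) 1)) ≠ ⊤)
    (hβ : (volume (symmDiff Ω (ball (0 : E2) 1))).toReal ≤ β) {x : E2}
    (hx : x ∉ interior Ω) : 1 - ‖x‖ ≤ 2 * Real.sqrt β := by
  obtain ⟨u, hu, hle⟩ := exists_unit_inner_le_norm hconv hint hx
  have hsub : ball (((1 + ‖x‖) / 2) • u) ((1 - ‖x‖) / 2) ⊆ symmDiff Ω (ball (0 : E2) 1) := by
    intro z hz
    rw [mem_ball, dist_eq_norm] at hz
    have hc : ‖((1 + ‖x‖) / 2) • u‖ = (1 + ‖x‖) / 2 := by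
      rw [norm_smul, hu, mul_one, Real.norm_of_nonneg (by positivity)]
    right
    refine ⟨?_, fun hzΩ => ?_⟩
    · have := norm_le_norm_add_norm_sub (((1 + ‖x‖) / 2) • u) z
      rw [mem_ball_zero_iff]
      rw [norm_sub_rev] at this
      linarith [norm_sub_rev z (((1 + ‖x‖) / 2) • u)]
    · have h1 := hle z hzΩ
      have h2 := neg_le_of_abs_le (abs_real_inner_le_norm u (z - ((1 + ‖x‖) / 2) • u))
      rw [inner_sub_right, real_inner_smul_right, real_inner_self_eq_norm_sq, hu] at h2
      linarith
  linarith [radius_le_sqrt_of_ball_subset hfin hβ hsub]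

/-- A point of a convex set containing the disc of radius `1 / 2` is at distance `O(√β)` from the
unit disc. -/
theorem norm_sub_one_le_of_mem {Ω : Set E2} {β : ℝ} (hconv : Convex ℝ Ω)
    (hhalf : ball (0 : E2) (1 / 2) ⊆ Ω) (hs : Real.sqrt β ≤ 1 / 4)
    (hfin : volume (symmDiff Ω (ball (0 : E2) 1)) ≠ ⊤)
    (hβ : (volume (symmDiff Ω (ball (0 : E2) 1))).toReal ≤ β) {a : E2}
    (ha : a ∈ Ω) : ‖a‖ - 1 ≤ 6 * Real.sqrt β := by
  rcases le_or_gt ‖a‖ 1 with h | h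
  · linarith [Real.sqrt_nonneg β]
  have hD : 0 < 2 * ‖a‖ + 1 := by positivity
  have hp : 0 < 2 * (‖a‖ - 1) / (2 * ‖a‖ + 1) := div_pos (by linarith) hD
  set p := 2 * (‖a‖ - 1) / (2 * ‖a‖ + 1) with hpdef
  have hpD : p * (2 * ‖a‖ + 1) = 2 * (‖a‖ - 1) := div_mul_cancel₀ _ hD.ne'
  have hp1 : p < 1 := by rw [hpdef, div_lt_one hD]; linarith
  have hsub : ball ((1 - p) • a) (p / 2) ⊆ symmDiff Ω (ball (0 : E2) 1) := by
    intro z hz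
    rw [mem_ball, dist_eq_norm] at hz
    left
    constructor
    · have hw : p⁻¹ • (z - (1 - p) • a) ∈ Ω := by
        apply hhalf
        rw [mem_ball_zero_iff, norm_smul, norm_inv, Real.norm_of_nonneg hp.le,
          inv_mul_lt_iff₀ hp]
        linarith
      have := hconv ha hw (by linarith : 0 ≤ 1 - p) hp.le (by ring)
      rwa [smul_inv_smul₀ hp.ne', add_sub_cancel] at this
    · rw [mem_ball_zero_iff, not_lt]
      have h1 : ‖(1 - p) • a‖ = (1 - p) * ‖a‖ := by
        rw [norm_smul, Real.norm_of_nonneg (by linarith)]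
      have h2 := norm_sub_norm_le ((1 - p) • a) z
      rw [norm_sub_rev] at h2
      nlinarith
  have hrad := radius_le_sqrt_of_ball_subset hfin hβ hsub
  have h3 : ‖a‖ - 1 ≤ Real.sqrt β * (2 * ‖a‖ + 1) := by
    nlinarith
  nlinarith [Real.sqrt_nonneg β]

/-- Lemma `LL9` of the paper: if `|Ω △ B₁(0)| ≤ β` then the radial boundary
point `a_θ` satisfies `||a_θ| − 1| ≤ c√β` (so `∂Ω ⊆ N_{c√β}(∂B₁(0))`) and any inward unit
normal at `a_θ` satisfies `|η_{a_θ} + θ| ≤ cβ^{1/4}`. -/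
theorem statement10 :
    ∃ c : ℝ, 0 < c ∧ ∃ β₀ : ℝ, 0 < β₀ ∧
      ∀ (β : ℝ) (Ω : Set E2), 0 < β → β ≤ β₀ →
        Convex ℝ Ω → IsCompact Ω → (interior Ω).Nonempty →
        (volume (symmDiff Ω (ball (0 : E2) 1))).toReal ≤ β →
        frontier Ω ⊆ Metric.thickening (c * Real.sqrt β) (sphere (0 : E2) 1) ∧
        ∀ θ ∈ sphere (0 : E2) 1, ∀ a : E2,
          a ∈ frontier Ω → (∃ t : ℝ, 0 < t ∧ a = t • θ) →
          |‖a‖ - 1| ≤ c * Real.sqrt β ∧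
          ∀ η : E2, IsInwardUnitNormal Ω a η → ‖η + θ‖ ≤ c * β ^ ((1 : ℝ) / 4) := by
  refine ⟨7, by norm_num, 1 / 16, by norm_num, ?_⟩
  intro β Ω hβ0 hβ1 hconv hcomp hint hβ
  have hs0 : 0 < Real.sqrt β := Real.sqrt_pos.mpr hβ0
  have hs : Real.sqrt β ≤ 1 / 4 := by
    rw [Real.sqrt_le_left (by norm_num)]
    linarith
  have hfin : volume (symmDiff Ω (ball (0 : E2) 1)) ≠ ⊤ := by
    refine measure_ne_top_of_subset (Set.symmDiff_subset_union) ?_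
    exact (measure_union_lt_top hcomp.measure_lt_top measure_ball_lt_top).ne
  have hinner : ∀ x : E2, 2 * Real.sqrt β < 1 - ‖x‖ → x ∈ interior Ω := by
    intro x hx
    by_contra hcon
    linarith [one_sub_norm_le_of_notMem_interior hconv hint hfin hβ hcon]
  have hhalf : ball (0 : E2) (1 / 2) ⊆ Ω := by
    intro x hx
    rw [mem_ball_zero_iff] at hx
    exact interior_subset (hinner x (by linarith))
  have hlow : ∀ a ∈ frontier Ω, 1 - ‖a‖ ≤ 2 * Real.sqrt β := fun a ha =>
    one_sub_norm_le_of_notMem_interior hconv hint hfin hβ ha.2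
  have hup : ∀ a ∈ frontier Ω, ‖a‖ - 1 ≤ 6 * Real.sqrt β := fun a ha =>
    norm_sub_one_le_of_mem hconv hhalf hs hfin hβ (hcomp.isClosed.frontier_subset ha)
  refine ⟨fun a ha => ?_, fun θ hθ a ha hat => ⟨?_, fun η hη => ?_⟩⟩
  · have h1 := hlow a ha
    have h2 := hup a ha
    have hapos : 0 < ‖a‖ := by linarith
    rw [mem_thickening_iff]
    refine ⟨‖a‖⁻¹ • a, ?_, ?_⟩
    · rw [mem_sphere_zero_iff_norm, norm_smul, norm_inv, norm_norm, inv_mul_cancel₀ hapos.ne']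
    · have h3 : a - ‖a‖⁻¹ • a = (1 - ‖a‖⁻¹) • a := by rw [sub_smul, one_smul]
      have h4 : (1 - ‖a‖⁻¹) * ‖a‖ = ‖a‖ - 1 := by field_simp
      rw [dist_eq_norm, h3, norm_smul, Real.norm_eq_abs, ← abs_of_pos hapos, ← abs_mul,
        abs_of_pos hapos, h4, abs_lt]
      constructor <;> linarith
  · have h1 := hlow a ha
    have h2 := hup a ha
    rw [abs_le]
    constructor <;> linarith
  · obtain ⟨t, ht, rfl⟩ := hat
    have hθ1 : ‖θ‖ = 1 := mem_sphere_zero_iff_norm.mp hθ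
    have hnorm : ‖t • θ‖ = t := by rw [norm_smul, hθ1, mul_one, Real.norm_of_nonneg ht.le]
    have h1 := hlow _ ha
    have h2 := hup _ ha
    rw [hnorm] at h1 h2
    have hz : (-(1 - 3 * Real.sqrt β)) • η ∈ Ω := by
      apply interior_subset
      apply hinner
      rw [norm_smul, hη.1, norm_neg, Real.norm_of_nonneg (by linarith)]
      linarith
    have h3 := hη.2 _ hz
    rw [inner_sub_right, real_inner_smul_right, real_inner_smul_right,
      real_inner_self_eq_norm_sq, hη.1] at h3
    have h4 : ‖η + θ‖ ^ 2 = 2 + 2 * ⟪η, θ⟫ := by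
      rw [norm_add_sq_real, hη.1, hθ1]
      ring
    have h5 : ‖η + θ‖ ^ 2 ≤ 36 * Real.sqrt β := by
      have h6 : t * ‖η + θ‖ ^ 2 ≤ 18 * Real.sqrt β := by
        rw [h4]
        linarith
      nlinarith [sq_nonneg ‖η + θ‖]
    have h7 : (β ^ ((1 : ℝ) / 4)) ^ 2 = Real.sqrt β := by
      rw [← Real.rpow_natCast, ← Real.rpow_mul hβ0.le, Real.sqrt_eq_rpow]
      norm_num
    have h8 : 0 ≤ β ^ ((1 : ℝ) / 4) := by positivity
    refine (sq_le_sq₀ (norm_nonneg _) (by positivity)).mp ?_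
    rw [mul_pow, h7]
    linarith
end
end

section
/- Let β > 0 be sufficiently small and let Ω ⊂ ℝ² be a convex body with |Ω △ B₁(0)| ≤ β. Let u(z) := d(z, ∂Ω). Then there exists a universal constant c such that for every x ∈ Ω\B_{β^{1/8}}(0) at which the (approximate) derivative ∇u(x) exists, one has |∇u(x) + x/|x|| ≤ c·β^{3/16}. -/
open MeasureTheory Metric
open scoped RealInnerProductSpace ENNReal

noncomputable section

section InnerProduct

variable {F : Type*} [NormedAddCommGroup F] [InnerProductSpace ℝ F]

/-- If a ball in a half-space touches its bounding hyperplane at `y`, the radius to `y` is along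
the normal. -/
lemma sub_eq_dist_smul_of_ball_subset {x y w : F} (hw : ‖w‖ = 1)
    (h : ∀ a ∈ ball x (dist x y), ⟪w, a⟫ ≤ ⟪w, y⟫) : y - x = dist x y • w := by
  have hd : dist x y = ‖y - x‖ := by rw [dist_comm, dist_eq_norm]
  have hge : dist x y ≤ ⟪w, y - x⟫ := by
    by_contra hlt
    push Not at hlt
    obtain ⟨r, hr1, hr2⟩ := exists_between (max_lt hlt (lt_of_le_of_ne dist_nonneg fun h0 => by
      rw [← h0, hd.symm.trans h0.symm |> norm_eq_zero.mp] at hlt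
      simp at hlt))
    have hr0 : 0 ≤ r := (le_max_right _ _).trans hr1.le
    have := h (x + r • w) (by
      rw [mem_ball, dist_eq_norm, add_sub_cancel_left, norm_smul, hw, mul_one, Real.norm_eq_abs,
        abs_of_nonneg hr0]
      exact hr2)
    rw [inner_add_right, real_inner_smul_right, real_inner_self_eq_norm_sq, hw] at this
    have h2 := (le_max_left _ _).trans_lt hr1
    rw [inner_sub_right] at h2
    linarith
  have hn : ‖y - x - dist x y • w‖ ^ 2 ≤ 0 := by
    rw [norm_sub_sq_real, norm_smul, hw, real_inner_smul_right, real_inner_comm, ← hd,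
      Real.norm_eq_abs, mul_one, sq_abs]
    nlinarith [dist_nonneg (x := x) (y := y)]
  have : ‖y - x - dist x y • w‖ = 0 := by
    nlinarith [norm_nonneg (y - x - dist x y • w)]
  exact sub_eq_zero.mp (norm_eq_zero.mp this)

variable [CompleteSpace F]

/-- A convex body has a unit outer normal at every point outside its interior. -/
lemma exists_unit_supporting_normal {s : Set F} (hs : Convex ℝ s) (hi : (interior s).Nonempty)
    {z : F} (hz : z ∉ interior s) :
    ∃ w : F, ‖w‖ = 1 ∧ ∀ a ∈ s, ⟪w, a⟫ ≤ ⟪w, z⟫ := by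
  obtain ⟨f, hf⟩ := geometric_hahn_banach_open_point hs.interior isOpen_interior hz
  set g : F := (InnerProductSpace.toDual ℝ F).symm f with hg
  have hgf : ∀ a, ⟪g, a⟫ = f a := fun a => InnerProductSpace.toDual_symm_apply
  have hle : ∀ a ∈ s, f a ≤ f z := by
    intro a ha
    have hcl : closure (interior s) ⊆ {b | f b ≤ f z} :=
      closure_minimal (fun b hb => (hf b hb).le) (isClosed_le f.continuous continuous_const)
    apply hcl
    rw [hs.closure_interior_eq_closure_of_nonempty_interior hi]
    exact subset_closure ha
  have hg0 : g ≠ 0 := by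
    intro h0
    obtain ⟨b, hb⟩ := hi
    have := hf b hb
    rw [← hgf, ← hgf, h0] at this
    simp at this
  have hpos : 0 < ‖g‖ := norm_pos_iff.mpr hg0
  refine ⟨‖g‖⁻¹ • g, ?_, fun a ha => ?_⟩
  · rw [norm_smul, norm_inv, norm_norm, inv_mul_cancel₀ hpos.ne']
  · rw [real_inner_smul_left, real_inner_smul_left, hgf, hgf]
    exact mul_le_mul_of_nonneg_left (hle a ha) (inv_nonneg.mpr hpos.le)

/-- At a point of differentiability, the gradient of a distance function points away from
every nearest point. -/
lemma infDist_smul_gradient_infDist {s : Set F} {x y : F} (hy : y ∈ s)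
    (hxy : infDist x s = dist x y) (hd : DifferentiableAt ℝ (fun z => infDist z s) x) :
    infDist x s • gradient (fun z => infDist z s) x = x - y := by
  have hG := hd.hasGradientAt
  generalize gradient (fun z => infDist z s) x = G at hG ⊢
  have h1 : HasFDerivAt (fun z => infDist z s ^ 2) _ x := hG.hasFDerivAt.pow 2
  have h2 : HasFDerivAt (fun z => ‖z - y‖ ^ 2) _ x := ((hasFDerivAt_id x).sub_const y).norm_sq
  have hmin : IsLocalMin (fun z => ‖z - y‖ ^ 2 - infDist z s ^ 2) x := by
    refine Filter.Eventually.of_forall fun z => ?_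
    have h3 : infDist z s ≤ ‖z - y‖ := by
      rw [← dist_eq_norm]; exact infDist_le_dist_of_mem hy
    have h4 : infDist z s ^ 2 ≤ ‖z - y‖ ^ 2 := pow_le_pow_left₀ infDist_nonneg h3 2
    have h5 : infDist x s = ‖x - y‖ := by rw [hxy, dist_eq_norm]
    simp only [h5]
    linarith
  have h0 := hmin.hasFDerivAt_eq_zero (h2.sub h1)
  refine ext_inner_right ℝ fun v => ?_
  have hv := DFunLike.congr_fun h0 v
  simp at hv
  rw [real_inner_smul_left, inner_sub_left]
  linarith

/-- The distance to the boundary of a convex body is not differentiable on the boundary. -/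
lemma not_differentiableAt_infDist_frontier {s : Set F} (hs : Convex ℝ s) (hc : IsClosed s)
    (hi : (interior s).Nonempty) {x : F} (hx : x ∈ frontier s) :
    ¬ DifferentiableAt ℝ (fun z => infDist z (frontier s)) x := by
  intro hd
  obtain ⟨w, hw, hsup⟩ := exists_unit_supporting_normal hs hi hx.2
  have hx0 : infDist x (frontier s) = 0 := infDist_zero_of_mem hx
  have hmin : IsLocalMin (fun z => infDist z (frontier s)) x :=
    Filter.Eventually.of_forall fun z => by simp only [hx0]; exact infDist_nonneg
  have hz := hd.hasFDerivAt
  rw [hmin.fderiv_eq_zero] at hz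
  have hline : HasDerivAt (fun r : ℝ => x + r • w) w 0 := by
    simpa using ((hasDerivAt_id (0 : ℝ)).smul_const w).const_add x
  have hcomp : HasDerivAt (fun r : ℝ => infDist (x + r • w) (frontier s)) 0 0 := by
    have hz' : HasFDerivAt (fun z => infDist z (frontier s)) (0 : F →L[ℝ] ℝ)
        (x + (0 : ℝ) • w) := by simpa using hz
    exact hz'.comp_hasDerivAt (0 : ℝ) hline
  have hlim := hcomp.tendsto_slope_zero_right
  have h1 : (1 : ℝ) ≤ 0 := by
    refine ge_of_tendsto hlim ?_
    filter_upwards [self_mem_nhdsWithin] with r hr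
    have hr : 0 < r := hr
    have hge : r ≤ infDist (x + r • w) (frontier s) := by
      rw [le_infDist ⟨x, hx⟩]
      intro p hp
      have hps := hsup p (hc.frontier_subset hp)
      have hcs : ⟪w, x + r • w - p⟫ ≤ ‖w‖ * ‖x + r • w - p‖ := real_inner_le_norm _ _
      rw [inner_sub_right, inner_add_right, real_inner_smul_right,
        real_inner_self_eq_norm_sq, hw] at hcs
      rw [dist_eq_norm]
      linarith
    simp only [zero_add, zero_smul, add_zero, hx0, sub_zero, smul_eq_mul]
    rw [inv_mul_eq_div, le_div_iff₀ hr]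
    linarith
  linarith

end InnerProduct

/-- The distance to the boundary of a compact set is attained, and the corresponding ball lies in
the set. -/
lemma exists_nearest_frontier {F : Type*} [NormedAddCommGroup F] [NormedSpace ℝ F]
    [FiniteDimensional ℝ F] {s : Set F} (hs : s ≠ Set.univ) {x : F} (hx : x ∈ s) :
    ∃ y ∈ frontier s, infDist x (frontier s) = dist x y ∧ ball x (dist x y) ⊆ s := by
  obtain ⟨y, hy, hxy⟩ := exists_mem_frontier_infDist_compl_eq_dist hx hs
  refine ⟨y, hy, le_antisymm (infDist_le_dist_of_mem hy) ?_, fun a ha => ?_⟩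
  · rw [← hxy, ← infDist_closure]
    refine infDist_le_infDist_of_subset ?_ ⟨y, hy⟩
    rw [frontier_eq_closure_inter_closure]
    exact Set.inter_subset_right
  · by_contra has
    have := infDist_le_dist_of_mem (x := x) (show a ∈ sᶜ from has)
    rw [mem_ball, dist_comm] at ha
    linarith

lemma exists_orthonormalBasis_zero_eq {w : E2} (hw : ‖w‖ = 1) :
    ∃ B : OrthonormalBasis (Fin 2) ℝ E2, B 0 = w := by
  obtain ⟨B, hB⟩ := Orthonormal.exists_orthonormalBasis_extension_of_card_eq (𝕜 := ℝ) (E := E2)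
    (ι := Fin 2) (by simp) (v := fun _ => w) (s := {0}) (by
      refine ⟨fun _ => hw, fun i j hij => ?_⟩
      exact absurd (Subsingleton.elim i j) hij)
  exact ⟨B, hB 0 rfl⟩

lemma norm_sq_eq_repr (B : OrthonormalBasis (Fin 2) ℝ E2) (z : E2) :
    ‖z‖ ^ 2 = B.repr z 0 ^ 2 + B.repr z 1 ^ 2 := by
  rw [← B.repr.norm_map, EuclideanSpace.norm_sq_eq]
  simp

lemma volume_rectangle (B : OrthonormalBasis (Fin 2) ℝ E2) {a b c : ℝ} (hab : a ≤ b)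
    (hc : 0 ≤ c) :
    (volume {z : E2 | a ≤ B.repr z 0 ∧ B.repr z 0 ≤ b ∧ |B.repr z 1| ≤ c}).toReal
      = (b - a) * (2 * c) := by
  have hmp := (EuclideanSpace.volume_preserving_symm_measurableEquiv_toLp (Fin 2)).comp
    B.measurePreserving_repr
  have hset : {z : E2 | a ≤ B.repr z 0 ∧ B.repr z 0 ≤ b ∧ |B.repr z 1| ≤ c}
      = ((MeasurableEquiv.toLp 2 (Fin 2 → ℝ)).symm ∘ B.repr) ⁻¹' Set.Icc ![a, -c] ![b, c] := by
    ext z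
    simp [Pi.le_def, Fin.forall_fin_two, abs_le]
    tauto
  rw [hset, hmp.measure_preimage measurableSet_Icc.nullMeasurableSet, Real.volume_Icc_pi_toReal]
  · simp; left; ring
  · intro i; fin_cases i
    · simpa using hab
    · simpa using hc

lemma rectangle_area_le {Ω : Set E2} (hΩ : IsCompact Ω) {β : ℝ}
    (hβ : (volume (symmDiff Ω (ball (0 : E2) 1))).toReal ≤ β)
    (B : OrthonormalBasis (Fin 2) ℝ E2) {a b c : ℝ} (hab : a ≤ b) (hc : 0 ≤ c)
    (hR : ∀ z : E2, a ≤ B.repr z 0 → B.repr z 0 ≤ b → |B.repr z 1| ≤ c →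
      z ∈ symmDiff Ω (ball (0 : E2) 1)) :
    (b - a) * (2 * c) ≤ β := by
  rw [← volume_rectangle B hab hc]
  refine le_trans (ENNReal.toReal_mono ?_ (measure_mono fun z hz => hR z hz.1 hz.2.1 hz.2.2)) hβ
  refine ((hΩ.isBounded.union (isBounded_ball (x := (0 : E2)) (r := 1))).subset ?_).measure_lt_top.ne
  exact symmDiff_le_sup

section NearBall

variable {Ω : Set E2} {t : ℝ}

/-- A half-plane containing a set close to the unit disc in measure almost reaches the unit
circle. -/
lemma one_sub_le_of_halfplane (hΩ : IsCompact Ω) (ht : 0 < t) (ht' : t ≤ 1 / 16)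
    (hβ : (volume (symmDiff Ω (ball (0 : E2) 1))).toReal ≤ t ^ 3) {w : E2} (hw : ‖w‖ = 1)
    {r : ℝ} (hr : ∀ a ∈ Ω, ⟪w, a⟫ ≤ r) : 1 - 4 * t ^ 2 ≤ r := by
  by_contra hlt
  push Not at hlt
  obtain ⟨B, rfl⟩ := exists_orthonormalBasis_zero_eq hw
  have key := rectangle_area_le hΩ hβ B (a := 1 - 4 * t ^ 2) (b := 1 - 2 * t ^ 2) (c := t)
    (by nlinarith) ht.le (by
      intro z h1 h2 h3
      refine Or.inr ⟨?_, fun hz => ?_⟩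
      · rw [mem_ball_zero_iff]
        have hsq := norm_sq_eq_repr B z
        have h4 : B.repr z 1 ^ 2 ≤ t ^ 2 := sq_le_sq' (abs_le.mp h3).1 (abs_le.mp h3).2
        have h5 : B.repr z 0 ^ 2 ≤ (1 - 2 * t ^ 2) ^ 2 := by
          apply pow_le_pow_left₀ _ h2
          nlinarith
        apply lt_of_pow_lt_pow_left₀ 2 zero_le_one
        have ht2 : t ^ 2 ≤ 1 / 256 := by nlinarith
        nlinarith [mul_pos ht ht]
      · have := hr z hz
        rw [← B.repr_apply_apply] at this
        linarith)
  nlinarith [pow_pos ht 3]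

lemma mem_of_norm_lt_one_sub (hΩ : IsCompact Ω) (hs : Convex ℝ Ω) (hi : (interior Ω).Nonempty)
    (ht : 0 < t) (ht' : t ≤ 1 / 16)
    (hβ : (volume (symmDiff Ω (ball (0 : E2) 1))).toReal ≤ t ^ 3) {z : E2}
    (hz : ‖z‖ < 1 - 4 * t ^ 2) : z ∈ Ω := by
  by_contra hn
  obtain ⟨w, hw, hsup⟩ := exists_unit_supporting_normal hs hi (fun h => hn (interior_subset h))
  have h1 := one_sub_le_of_halfplane hΩ ht ht' hβ hw hsup
  have h2 := real_inner_le_norm w z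
  rw [hw] at h2
  linarith

lemma norm_le_one_add (hΩ : IsCompact Ω) (hs : Convex ℝ Ω) (hi : (interior Ω).Nonempty)
    (ht : 0 < t) (ht' : t ≤ 1 / 16)
    (hβ : (volume (symmDiff Ω (ball (0 : E2) 1))).toReal ≤ t ^ 3) {y : E2} (hy : y ∈ Ω) :
    ‖y‖ ≤ 1 + 16 * t ^ 2 := by
  by_contra hlt
  push Not at hlt
  have htt : t ^ 2 ≤ 1 / 256 := by nlinarith
  have ht2 : 0 < t ^ 2 := by positivity
  have hypos : 0 < ‖y‖ := by linarith
  have hw : ‖‖y‖⁻¹ • y‖ = 1 := by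
    rw [norm_smul, norm_inv, norm_norm, inv_mul_cancel₀ hypos.ne']
  obtain ⟨B, hB⟩ := exists_orthonormalBasis_zero_eq hw
  have h0 : (0 : E2) ∈ Ω := mem_of_norm_lt_one_sub hΩ hs hi ht ht' hβ (by rw [norm_zero]; linarith)
  have hq : (1 + 16 * t ^ 2) • B 0 ∈ Ω := by
    have := hs.smul_mem_of_zero_mem h0 hy (t := (1 + 16 * t ^ 2) * ‖y‖⁻¹)
      ⟨by positivity, by rw [← div_eq_mul_inv, div_le_one hypos]; exact hlt.le⟩
    rwa [mul_smul, ← hB] at this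
  have key := rectangle_area_le hΩ hβ B (a := 1) (b := 1 + 8 * t ^ 2) (c := t / 2)
    (by linarith) (by linarith) (by
      intro z h1 h2 h3
      have hsq := norm_sq_eq_repr B z
      refine Or.inl ⟨?_, fun hz => ?_⟩
      · set α := B.repr z 0 with hα
        set γ := B.repr z 1 with hγ
        set l : ℝ := (1 + 16 * t ^ 2 - α) / (48 * t ^ 2) with hl
        have hl1 : 1 / 6 ≤ l := by rw [hl, le_div_iff₀ (by positivity)]; linarith
        have hl2 : l ≤ 1 := by rw [hl, div_le_one (by positivity)]; linarith
        have hl0 : 0 < l := by linarith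
        have hl3 : l * (48 * t ^ 2) = 1 + 16 * t ^ 2 - α := by
          rw [hl]; field_simp
        set p : E2 := (1 - 32 * t ^ 2) • B 0 + (γ / l) • B 1 with hp
        have hp0 : B.repr p 0 = 1 - 32 * t ^ 2 := by
          simp [hp, B.repr_self]
        have hp1 : B.repr p 1 = γ / l := by
          simp [hp, B.repr_self]
        have hpΩ : p ∈ Ω := by
          apply mem_of_norm_lt_one_sub hΩ hs hi ht ht' hβ
          have hpn := norm_sq_eq_repr B p
          rw [hp0, hp1] at hpn
          have hγl : |γ / l| ≤ 3 * t := by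
            rw [abs_div, abs_of_pos hl0, div_le_iff₀ hl0]
            nlinarith
          have hγ2 : (γ / l) ^ 2 ≤ (3 * t) ^ 2 := sq_le_sq' (abs_le.mp hγl).1 (abs_le.mp hγl).2
          apply lt_of_pow_lt_pow_left₀ 2 (by linarith)
          nlinarith
        have hz : z = (1 - l) • ((1 + 16 * t ^ 2) • B 0) + l • p := by
          have hz0 : z = α • B 0 + γ • B 1 := by
            have := B.sum_repr z
            rw [Fin.sum_univ_two] at this
            exact this.symm
          rw [hz0, hp, smul_add, smul_smul, smul_smul, smul_smul, ← add_assoc, ← add_smul,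
            mul_div_cancel₀ _ hl0.ne']
          congr 2
          linarith
        rw [hz]
        exact hs hq hpΩ (by linarith) hl0.le (by ring)
      · rw [mem_ball_zero_iff] at hz
        nlinarith [norm_nonneg z, sq_nonneg (B.repr z 1)])
  nlinarith [pow_pos ht 3]

end NearBall

/-- Lemma `LL25` of the paper: if `|Ω △ B₁(0)| ≤ β` and `u = d(·, ∂Ω)`, then at
every point `x ∈ Ω \ B_{β^{1/8}}(0)` of differentiability, `|∇u(x) + x/|x|| ≤ cβ^{3/16}`. -/
theorem statement13 :
    ∃ c : ℝ, 0 < c ∧ ∃ β₀ : ℝ, 0 < β₀ ∧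
      ∀ (β : ℝ) (Ω : Set E2), 0 < β → β ≤ β₀ →
        Convex ℝ Ω → IsCompact Ω → (interior Ω).Nonempty →
        (volume (symmDiff Ω (ball (0 : E2) 1))).toReal ≤ β →
        ∀ x ∈ Ω \ ball (0 : E2) (β ^ ((1 : ℝ) / 8)),
          DifferentiableAt ℝ (fun z => Metric.infDist z (frontier Ω)) x →
          ‖gradient (fun z => Metric.infDist z (frontier Ω)) x + ‖x‖⁻¹ • x‖ ≤
            c * β ^ ((3 : ℝ) / 16) := by
  refine ⟨14, by norm_num, 1 / 4096, by norm_num, ?_⟩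
  intro β Ω hβ0 hβ1 hs hΩ hi hvol x hx hd
  obtain ⟨t, ht, ht', htβ⟩ : ∃ t : ℝ, 0 < t ∧ t ≤ 1 / 16 ∧ t = β ^ ((1 : ℝ) / 3) := by
    refine ⟨_, by positivity, ?_, rfl⟩
    calc β ^ ((1 : ℝ) / 3) ≤ ((1 / 16 : ℝ) ^ (3 : ℝ)) ^ ((1 : ℝ) / 3) := by
          apply Real.rpow_le_rpow hβ0.le _ (by norm_num)
          norm_num at hβ1 ⊢
          exact hβ1
      _ = 1 / 16 := by rw [← Real.rpow_mul (by norm_num)]; norm_num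
  have ht3 : t ^ 3 = β := by
    rw [htβ, ← Real.rpow_natCast, ← Real.rpow_mul hβ0.le]; norm_num
  have hvol' : (volume (symmDiff Ω (ball (0 : E2) 1))).toReal ≤ t ^ 3 := by rwa [ht3]
  have hxn : β ^ ((1 : ℝ) / 8) ≤ ‖x‖ := by
    have := hx.2
    rwa [mem_ball_zero_iff, not_lt] at this
  have hxt : t ≤ ‖x‖ := by
    refine le_trans ?_ hxn
    rw [htβ]
    exact Real.rpow_le_rpow_of_exponent_ge hβ0 (by linarith) (by norm_num)
  have hxpos : 0 < ‖x‖ := by linarith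
  obtain ⟨y, hy, hxy, hball⟩ := exists_nearest_frontier (hΩ.ne_univ) hx.1
  obtain ⟨w, hw, hsup⟩ := exists_unit_supporting_normal hs hi hy.2
  have hyx := sub_eq_dist_smul_of_ball_subset hw (fun a ha => hsup a (hball ha))
  have hyΩ : y ∈ Ω := hΩ.isClosed.frontier_subset hy
  have hdpos : 0 < dist x y := by
    rw [dist_pos]
    rintro rfl
    exact not_differentiableAt_infDist_frontier hs hΩ.isClosed hi hy hd
  have hgrad : gradient (fun z => infDist z (frontier Ω)) x = -w := by
    have h := infDist_smul_gradient_infDist hy hxy hd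
    rw [hxy, ← neg_sub y x, hyx, ← smul_neg] at h
    exact smul_right_injective E2 hdpos.ne' h
  set d := dist x y with hddef
  have hyin : 1 - 4 * t ^ 2 ≤ ⟪w, y⟫ := one_sub_le_of_halfplane hΩ ht ht' hvol' hw hsup
  have hyout : ‖y‖ ≤ 1 + 16 * t ^ 2 := norm_le_one_add hΩ hs hi ht ht' hvol' hyΩ
  have hwy : ‖y - w‖ ≤ 7 * t := by
    have h1 : ‖y - w‖ ^ 2 ≤ (7 * t) ^ 2 := by
      rw [norm_sub_sq_real, hw, real_inner_comm]
      have : ‖y‖ ^ 2 ≤ (1 + 16 * t ^ 2) ^ 2 := pow_le_pow_left₀ (norm_nonneg _) hyout 2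
      nlinarith [mul_pos ht ht]
    exact le_of_sq_le_sq h1 (by positivity)
  have hd1 : ‖x‖ + d ≤ 1 + 16 * t ^ 2 := by
    have hmem : x + (d * ‖x‖⁻¹) • x ∈ Ω := by
      apply hΩ.isClosed.closure_subset_iff.mpr hball
      rw [closure_ball x hdpos.ne', mem_closedBall, dist_eq_norm, add_sub_cancel_left, norm_smul,
        Real.norm_of_nonneg (by positivity), mul_assoc, inv_mul_cancel₀ hxpos.ne', mul_one]
    have hnorm := norm_le_one_add hΩ hs hi ht ht' hvol' hmem
    have heq : x + (d * ‖x‖⁻¹) • x = (1 + d * ‖x‖⁻¹) • x := by rw [add_smul, one_smul]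
    rw [heq, norm_smul, Real.norm_of_nonneg (by positivity), add_mul, mul_assoc,
      inv_mul_cancel₀ hxpos.ne'] at hnorm
    linarith
  have hd2 : 0 ≤ 1 - d := by nlinarith
  have he : x - (1 - d) • w = y - w := by
    rw [sub_smul, ← hyx, one_smul]; abel
  have hxw : ‖x - ‖x‖ • w‖ ≤ 14 * t := by
    have h1 : |‖x‖ - (1 - d)| ≤ 7 * t := by
      have h2 := abs_norm_sub_norm_le x ((1 - d) • w)
      rw [he, norm_smul, hw, mul_one, Real.norm_of_nonneg hd2] at h2
      exact h2.trans hwy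
    have h3 : x - ‖x‖ • w = (y - w) - (‖x‖ - (1 - d)) • w := by
      rw [← he]; module
    rw [h3]
    refine (norm_sub_le _ _).trans ?_
    rw [norm_smul, hw, mul_one, Real.norm_eq_abs]
    linarith
  have hfin : ‖-w + ‖x‖⁻¹ • x‖ * ‖x‖ ≤ 14 * t := by
    have h1 : x - ‖x‖ • w = ‖x‖ • (-w + ‖x‖⁻¹ • x) := by
      rw [smul_add, smul_smul, mul_inv_cancel₀ hxpos.ne', one_smul, smul_neg]; abel
    rw [h1, norm_smul, norm_norm] at hxw
    linarith
  have hpow : t ≤ β ^ ((3 : ℝ) / 16) * β ^ ((1 : ℝ) / 8) := by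
    rw [htβ, ← Real.rpow_add hβ0]
    exact Real.rpow_le_rpow_of_exponent_ge hβ0 (by linarith) (by norm_num)
  rw [hgrad]
  refine le_of_mul_le_mul_right ?_ hxpos
  have h4 : β ^ ((3 : ℝ) / 16) * β ^ ((1 : ℝ) / 8) ≤ β ^ ((3 : ℝ) / 16) * ‖x‖ := by gcongr
  linarith
end
end
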